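/- arXiv:math/0512657 — 12 statements merged into one kernel-verified Lean document; each statement's English description precedes it below -/
import Mathlib

section
/- Let f₁ and f₂ be nonzero rational functions in one variable over ℚ, and suppose each f_k (k = 1,2) can be written as a quotient p_k/q_k of two nonzero polynomials all of whose coefficients are nonnegative. Then intDegree(f₁ + f₂) = max(intDegree f₁, intDegree f₂). -/
/-- A nonzero rational function over `ℚ` is *positive* if it can be written as a quotient
of two nonzero polynomials all of whose coefficients are nonnegative. -/
def RatFunc.IsPositive (f : RatFunc ℚ) : Prop :=
  ∃ p q : Polynomial ℚ, p ≠ 0 ∧ q ≠ 0 ∧ (∀ n, 0 ≤ p.coeff n) ∧ (∀ n, 0 ≤ q.coeff n) ∧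
    f = algebraMap (Polynomial ℚ) (RatFunc ℚ) p / algebraMap (Polynomial ℚ) (RatFunc ℚ) q

/-- Polynomials with nonnegative coefficients admit no cancellation of leading terms. -/
theorem Polynomial.natDegree_add_of_coeff_nonneg {R : Type*} [Semiring R] [PartialOrder R]
    [IsOrderedAddMonoid R] {p q : Polynomial R}
    (hp : ∀ n, 0 ≤ p.coeff n) (hq : ∀ n, 0 ≤ q.coeff n) :
    (p + q).natDegree = max p.natDegree q.natDegree := by
  refine le_antisymm (Polynomial.natDegree_add_le p q) (max_le ?_ ?_)
  · by_cases h : p = 0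
    · simp [h]
    refine Polynomial.le_natDegree_of_ne_zero fun h0 => h ?_
    rw [Polynomial.coeff_add, add_eq_zero_iff_of_nonneg (hp _) (hq _)] at h0
    exact Polynomial.leadingCoeff_eq_zero.mp h0.1
  · by_cases h : q = 0
    · simp [h]
    refine Polynomial.le_natDegree_of_ne_zero fun h0 => h ?_
    rw [Polynomial.coeff_add, add_eq_zero_iff_of_nonneg (hp _) (hq _)] at h0
    exact Polynomial.leadingCoeff_eq_zero.mp h0.2

theorem Polynomial.add_ne_zero_of_coeff_nonneg {R : Type*} [Semiring R] [PartialOrder R]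
    [IsOrderedAddMonoid R] {p q : Polynomial R} (h : p ≠ 0)
    (hp : ∀ n, 0 ≤ p.coeff n) (hq : ∀ n, 0 ≤ q.coeff n) : p + q ≠ 0 := by
  intro h0
  refine h (Polynomial.ext fun n => ?_)
  have hn := congrArg (fun r => Polynomial.coeff r n) h0
  simp only [Polynomial.coeff_add, Polynomial.coeff_zero] at hn
  exact ((add_eq_zero_iff_of_nonneg (hp n) (hq n)).mp hn).1

theorem Polynomial.coeff_mul_nonneg {R : Type*} [Semiring R] [PartialOrder R]
    [IsOrderedRing R] {p q : Polynomial R}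
    (hp : ∀ n, 0 ≤ p.coeff n) (hq : ∀ n, 0 ≤ q.coeff n) (n : ℕ) : 0 ≤ (p * q).coeff n := by
  rw [Polynomial.coeff_mul]
  exact Finset.sum_nonneg fun i _ => mul_nonneg (hp _) (hq _)

theorem RatFunc.intDegree_algebraMap_div {K : Type*} [Field K] {p q : Polynomial K}
    (hp : p ≠ 0) (hq : q ≠ 0) :
    (algebraMap (Polynomial K) (RatFunc K) p / algebraMap (Polynomial K) (RatFunc K) q).intDegree
      = (p.natDegree : ℤ) - q.natDegree := by
  rw [RatFunc.intDegree_div (RatFunc.algebraMap_ne_zero hp) (RatFunc.algebraMap_ne_zero hq),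
    RatFunc.intDegree_polynomial, RatFunc.intDegree_polynomial]

/-- The valuation identity `v(f₁ + f₂) = max (v f₁) (v f₂)` for positive rational
functions, where `v = intDegree` is the degree of the pole at infinity. -/
theorem stmt0 (f₁ f₂ : RatFunc ℚ) (h₁ : f₁ ≠ 0) (h₂ : f₂ ≠ 0)
    (hp₁ : f₁.IsPositive) (hp₂ : f₂.IsPositive) :
    (f₁ + f₂).intDegree = max f₁.intDegree f₂.intDegree := by
  obtain ⟨p₁, q₁, hp₁, hq₁, hp₁', hq₁', rfl⟩ := hp₁
  obtain ⟨p₂, q₂, hp₂, hq₂, hp₂', hq₂', rfl⟩ := hp₂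
  have hl := Polynomial.coeff_mul_nonneg hp₁' hq₂'
  have hr := Polynomial.coeff_mul_nonneg hq₁' hp₂'
  rw [div_add_div _ _ (RatFunc.algebraMap_ne_zero hq₁) (RatFunc.algebraMap_ne_zero hq₂),
    ← map_mul, ← map_mul, ← map_mul, ← map_add,
    RatFunc.intDegree_algebraMap_div
      (Polynomial.add_ne_zero_of_coeff_nonneg (mul_ne_zero hp₁ hq₂) hl hr) (mul_ne_zero hq₁ hq₂),
    RatFunc.intDegree_algebraMap_div hp₁ hq₁, RatFunc.intDegree_algebraMap_div hp₂ hq₂,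
    Polynomial.natDegree_add_of_coeff_nonneg hl hr, Polynomial.natDegree_mul hp₁ hq₂,
    Polynomial.natDegree_mul hq₁ hp₂, Polynomial.natDegree_mul hq₁ hq₂]
  omega
end

section
/- Let X denote the generator of the field ℚ(X) of rational functions in one variable. For all integers γ, a, b, the rational function (X^γ · X^a + X^b)/(X^a + X^b) (integer powers taken via zpow in the field ℚ(X)) has intDegree equal to max(γ + a, b) − max(a, b). -/
namespace RatFunc

variable {K : Type*} [Field K]

theorem intDegree_X_zpow (n : ℤ) : intDegree ((X : RatFunc K) ^ n) = n := by
  have h_pow (k : ℕ) : intDegree ((X : RatFunc K) ^ k) = k := by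
    rw [← algebraMap_X, ← map_pow, intDegree_polynomial, Polynomial.natDegree_X_pow]
  obtain ⟨k, rfl | rfl⟩ := n.eq_nat_or_neg
  · rw [zpow_natCast, h_pow]
  · rw [zpow_neg, zpow_natCast, intDegree_inv, h_pow]

theorem X_zpow_add_X_zpow_eq {m n : ℤ} (h : n ≤ m) :
    (X : RatFunc K) ^ m + X ^ n =
      X ^ n * algebraMap (Polynomial K) (RatFunc K)
        (Polynomial.X ^ (m - n).toNat + Polynomial.C 1) := by
  rw [map_add, map_pow, algebraMap_X, Polynomial.C_1, map_one, mul_add, mul_one,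
    ← zpow_natCast, ← zpow_add₀ X_ne_zero, Int.toNat_of_nonneg (by lia), add_sub_cancel]

variable [NeZero (2 : K)]

theorem algebraMap_X_pow_add_one_ne_zero (k : ℕ) :
    algebraMap (Polynomial K) (RatFunc K) (Polynomial.X ^ k + Polynomial.C 1) ≠ 0 := by
  refine algebraMap_ne_zero fun h => two_ne_zero (α := K) ?_
  simpa [one_add_one_eq_two] using congrArg (Polynomial.eval 1) h

theorem X_zpow_add_X_zpow_ne_zero (m n : ℤ) : (X : RatFunc K) ^ m + X ^ n ≠ 0 := by
  wlog h : n ≤ m generalizing m n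
  · rw [add_comm]
    exact this n m (by lia)
  rw [X_zpow_add_X_zpow_eq h]
  exact mul_ne_zero (zpow_ne_zero _ X_ne_zero) (algebraMap_X_pow_add_one_ne_zero _)

theorem intDegree_X_zpow_add_X_zpow (m n : ℤ) :
    intDegree ((X : RatFunc K) ^ m + X ^ n) = max m n := by
  wlog h : n ≤ m generalizing m n
  · rw [add_comm, max_comm]
    exact this n m (by lia)
  rw [X_zpow_add_X_zpow_eq h, intDegree_mul (zpow_ne_zero _ X_ne_zero)
    (algebraMap_X_pow_add_one_ne_zero _), intDegree_X_zpow, intDegree_polynomial,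
    Polynomial.natDegree_X_pow_add_C]
  lia

end RatFunc

/-- The ultra-discretization formula
`UD((c·x + y)/(x + y)) = max (c + x) y − max x y`, as the statement that the rational
function `(X^γ · X^a + X^b)/(X^a + X^b)` in `ℚ(X)` has `intDegree` equal to
`max (γ + a) b - max a b`. -/
theorem stmt1 (γ a b : ℤ) :
    RatFunc.intDegree
        (((RatFunc.X : RatFunc ℚ) ^ γ * (RatFunc.X : RatFunc ℚ) ^ a
            + (RatFunc.X : RatFunc ℚ) ^ b) /
          ((RatFunc.X : RatFunc ℚ) ^ a + (RatFunc.X : RatFunc ℚ) ^ b)) =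
      max (γ + a) b - max a b := by
  rw [← zpow_add₀ RatFunc.X_ne_zero,
    RatFunc.intDegree_div (RatFunc.X_zpow_add_X_zpow_ne_zero _ _)
      (RatFunc.X_zpow_add_X_zpow_ne_zero _ _),
    RatFunc.intDegree_X_zpow_add_X_zpow, RatFunc.intDegree_X_zpow_add_X_zpow]
end

section
/- Fix n ≥ 2 and let F be the field of rational functions over ℚ in the 2n indeterminates x_0, x_1, …, x_n, x̄_{n−1}, …, x̄_1. For a tuple z = (z_0, z_1, …, z_n, z̄_{n−1}, …, z̄_1) of nonzero elements of F set A(z) = (z_{n−1}z̄_{n−1} + z_n)/(z_{n−1}z_n) and define σ̄(z) = (y_0, y_1, …, y_n, ȳ_{n−1}, …, ȳ_1) by: y_0 = z_n·A(z)²; y_i = A(z)·(z_{n−i−1}z̄_{n−i−1} + z_{n−i}z̄_{n−i})/z_{n−i−1} for 1 ≤ i ≤ n−2; y_{n−1} = A(z)·(z_0 + z_1z̄_1)/z_0; y_n = z_0·A(z)²; ȳ_i = A(z)·z_{n−i−1}z_{n−i}z̄_{n−i}/(z_{n−i−1}z̄_{n−i−1} + z_{n−i}z̄_{n−i}) for 1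 ≤ i ≤ n−2; ȳ_{n−1} = A(z)·z_0z_1z̄_1/(z_0 + z_1z̄_1). Then for the tuple x of indeterminates, all denominators occurring are nonzero and σ̄(σ̄(x)) = x; in particular σ̄ is a birational involution. -/
noncomputable section

/-- The index set of the `2n` indeterminates `x_0, x_1, …, x_n, x̄_1, …, x̄_{n-1}`. -/
abbrev Vars4 (n : ℕ) : Type := Fin (n + 1) ⊕ Fin (n - 1)

/-- The field of rational functions over `ℚ` in the indeterminates
`x_0, x_1, …, x_n, x̄_{n-1}, …, x̄_1`. -/
abbrev F4 (n : ℕ) : Type := FractionRing (MvPolynomial (Vars4 n) ℚ)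

/-- A polynomial which does not vanish at `(1, …, 1)` is nonzero as a rational function. -/
theorem algebraMap_ne_zero_of_eval_one_ne_zero {σ : Type*} (p : MvPolynomial σ ℚ)
    (hp : MvPolynomial.eval (fun _ => 1) p ≠ 0) :
    algebraMap (MvPolynomial σ ℚ) (FractionRing (MvPolynomial σ ℚ)) p ≠ 0 := by
  intro h
  have h0 : p = 0 := IsFractionRing.injective (MvPolynomial σ ℚ)
    (FractionRing (MvPolynomial σ ℚ)) (h.trans (map_zero _).symm)
  exact hp (by simp [h0])

theorem div_mul_mul_div_cancel_middle {K : Type*} [Field K] {A S a b c : K} (ha : a ≠ 0)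
    (hS : S ≠ 0) :
    A * S / a * (A * (a * b * c) / S) = A ^ 2 * (b * c) := by
  field_simp

/-- The birational map `σ̄` used in the construction of the affine geometric crystal
`V(C_n^{(1)})` is an involution: all denominators occurring are nonzero and
`σ̄(σ̄(x)) = x`.  Here `(y, ȳ) = σ̄(x, x̄)` and `(w, w̄) = σ̄(y, ȳ)` are given by the
same formulas, with `A = A(x)` and `A' = A(y)` the respective factors. -/
theorem stmt4 (n : ℕ) (hn : 2 ≤ n)
    (x xb : ℕ → F4 n)
    (hx : ∀ i (h : i ≤ n),
      x i = algebraMap (MvPolynomial (Vars4 n) ℚ) (F4 n)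
        (MvPolynomial.X (Sum.inl ⟨i, by omega⟩)))
    (hxb : ∀ i (h1 : 1 ≤ i) (h2 : i ≤ n - 1),
      xb i = algebraMap (MvPolynomial (Vars4 n) ℚ) (F4 n)
        (MvPolynomial.X (Sum.inr ⟨i - 1, by omega⟩)))
    (A : F4 n) (hA : A = (x (n-1) * xb (n-1) + x n) / (x (n-1) * x n))
    (y yb : ℕ → F4 n)
    (hy0 : y 0 = x n * A ^ 2)
    (hyi : ∀ i, 1 ≤ i → i ≤ n - 2 →
      y i = A * (x (n-i-1) * xb (n-i-1) + x (n-i) * xb (n-i)) / x (n-i-1))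
    (hyn1 : y (n-1) = A * (x 0 + x 1 * xb 1) / x 0)
    (hyn : y n = x 0 * A ^ 2)
    (hybi : ∀ i, 1 ≤ i → i ≤ n - 2 →
      yb i = A * (x (n-i-1) * x (n-i) * xb (n-i))
        / (x (n-i-1) * xb (n-i-1) + x (n-i) * xb (n-i)))
    (hybn1 : yb (n-1) = A * (x 0 * x 1 * xb 1) / (x 0 + x 1 * xb 1))
    (A' : F4 n) (hA' : A' = (y (n-1) * yb (n-1) + y n) / (y (n-1) * y n))
    (w wb : ℕ → F4 n)
    (hw0 : w 0 = y n * A' ^ 2)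
    (hwi : ∀ i, 1 ≤ i → i ≤ n - 2 →
      w i = A' * (y (n-i-1) * yb (n-i-1) + y (n-i) * yb (n-i)) / y (n-i-1))
    (hwn1 : w (n-1) = A' * (y 0 + y 1 * yb 1) / y 0)
    (hwn : w n = y 0 * A' ^ 2)
    (hwbi : ∀ i, 1 ≤ i → i ≤ n - 2 →
      wb i = A' * (y (n-i-1) * y (n-i) * yb (n-i))
        / (y (n-i-1) * yb (n-i-1) + y (n-i) * yb (n-i)))
    (hwbn1 : wb (n-1) = A' * (y 0 * y 1 * yb 1) / (y 0 + y 1 * yb 1)) :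
    x (n-1) * x n ≠ 0 ∧ x 0 ≠ 0 ∧ x 0 + x 1 * xb 1 ≠ 0 ∧
    (∀ i, 1 ≤ i → i ≤ n - 2 →
      x (n-i-1) ≠ 0 ∧ x (n-i-1) * xb (n-i-1) + x (n-i) * xb (n-i) ≠ 0) ∧
    y (n-1) * y n ≠ 0 ∧ y 0 ≠ 0 ∧ y 0 + y 1 * yb 1 ≠ 0 ∧
    (∀ i, 1 ≤ i → i ≤ n - 2 →
      y (n-i-1) ≠ 0 ∧ y (n-i-1) * yb (n-i-1) + y (n-i) * yb (n-i) ≠ 0) ∧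
    (∀ i, i ≤ n → w i = x i) ∧
    (∀ i, 1 ≤ i → i ≤ n - 1 → wb i = xb i) := by
  have hx_ne : ∀ i, i ≤ n → x i ≠ 0 := fun i h => by
    rw [hx i h]
    exact algebraMap_ne_zero_of_eval_one_ne_zero _ (by simp)
  have hS0 : x 0 + x 1 * xb 1 ≠ 0 := by
    rw [hx 0 (by omega), hx 1 (by omega), hxb 1 le_rfl (by omega), ← map_mul, ← map_add]
    exact algebraMap_ne_zero_of_eval_one_ne_zero _ (by norm_num)
  have hSn : x (n-1) * xb (n-1) + x n ≠ 0 := by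
    rw [hx n le_rfl, hx (n-1) (by omega), hxb (n-1) (by omega) le_rfl, ← map_mul, ← map_add]
    exact algebraMap_ne_zero_of_eval_one_ne_zero _ (by norm_num)
  have hS : ∀ i, 1 ≤ i → i ≤ n - 2 →
      x (n-i-1) * xb (n-i-1) + x (n-i) * xb (n-i) ≠ 0 := fun i h1 h2 => by
    rw [hx (n-i) (by omega), hx (n-i-1) (by omega), hxb (n-i) (by omega) (by omega),
      hxb (n-i-1) (by omega) (by omega), ← map_mul, ← map_mul, ← map_add]
    exact algebraMap_ne_zero_of_eval_one_ne_zero _ (by norm_num)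
  have hx0 : x 0 ≠ 0 := hx_ne 0 (by omega)
  have hxn : x n ≠ 0 := hx_ne n le_rfl
  have hxn1 : x (n-1) ≠ 0 := hx_ne (n-1) (by omega)
  have hA_ne : A ≠ 0 := by
    rw [hA]
    exact div_ne_zero hSn (mul_ne_zero hxn1 hxn)
  have hy0_ne : y 0 ≠ 0 := by
    rw [hy0]
    exact mul_ne_zero hxn (pow_ne_zero _ hA_ne)
  have hyn_ne : y n ≠ 0 := by
    rw [hyn]
    exact mul_ne_zero hx0 (pow_ne_zero _ hA_ne)
  have hyn1_ne : y (n-1) ≠ 0 := by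
    rw [hyn1]
    exact div_ne_zero (mul_ne_zero hA_ne hS0) hx0
  have hyi_ne : ∀ i, 1 ≤ i → i ≤ n - 2 → y i ≠ 0 := fun i h1 h2 => by
    rw [hyi i h1 h2]
    exact div_ne_zero (mul_ne_zero hA_ne (hS i h1 h2)) (hx_ne _ (by omega))
  have hprod_n1 : y (n-1) * yb (n-1) = A ^ 2 * (x 1 * xb 1) := by
    rw [hyn1, hybn1]
    exact div_mul_mul_div_cancel_middle hx0 hS0
  have hprod : ∀ i, 1 ≤ i → i ≤ n - 1 → y i * yb i = A ^ 2 * (x (n-i) * xb (n-i)) :=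
    fun i h1 h2 => by
      rcases eq_or_lt_of_le h2 with rfl | h
      · rw [hprod_n1, show n - (n - 1) = 1 by omega]
      · rw [hyi i h1 (by omega), hybi i h1 (by omega)]
        exact div_mul_mul_div_cancel_middle (hx_ne _ (by omega)) (hS i h1 (by omega))
  have hT0 : y 0 + y 1 * yb 1 = A ^ 2 * (x (n-1) * xb (n-1) + x n) := by
    rw [hprod 1 le_rfl (by omega), hy0]
    ring
  have hT : ∀ i, 1 ≤ i → i ≤ n - 2 →
      y (n-i-1) * yb (n-i-1) + y (n-i) * yb (n-i)
        = A ^ 2 * (x i * xb i + x (i+1) * xb (i+1)) := fun i h1 h2 => by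
    rw [hprod (n-i-1) (by omega) (by omega), hprod (n-i) (by omega) (by omega),
      show n - (n - i - 1) = i + 1 by omega, show n - (n - i) = i by omega]
    ring
  have hS' : ∀ i, 1 ≤ i → i ≤ n - 2 → x i * xb i + x (i+1) * xb (i+1) ≠ 0 :=
    fun i h1 h2 => by
      have := hS (n-i-1) (by omega) (by omega)
      rwa [show n - (n - i - 1) - 1 = i by omega, show n - (n - i - 1) = i + 1 by omega] at this
  have hy_rev : ∀ i, 1 ≤ i → i ≤ n - 2 →
      y (n-i-1) = A * (x i * xb i + x (i+1) * xb (i+1)) / x i := fun i h1 h2 => by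
    rw [hyi (n-i-1) (by omega) (by omega), show n - (n - i - 1) - 1 = i by omega,
      show n - (n - i - 1) = i + 1 by omega]
  have hA'_inv : A' = A⁻¹ := by
    rw [hA', hprod_n1, hyn, hyn1]
    field_simp
    ring
  have hw_n1 : w (n-1) = x (n-1) := by
    rw [hwn1, hT0, hy0, hA'_inv, hA]
    field_simp
  have hw_i : ∀ i, 1 ≤ i → i ≤ n - 2 → w i = x i := fun i h1 h2 => by
    have h3 := hS' i h1 h2
    have h4 := hx_ne i (by omega)
    rw [hwi i h1 h2, hT i h1 h2, hy_rev i h1 h2, hA'_inv]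
    field_simp
  have hT0_ne : y 0 + y 1 * yb 1 ≠ 0 := by
    rw [hT0]
    exact mul_ne_zero (pow_ne_zero _ hA_ne) hSn
  have hT_ne : ∀ i, 1 ≤ i → i ≤ n - 2 →
      y (n-i-1) * yb (n-i-1) + y (n-i) * yb (n-i) ≠ 0 := fun i h1 h2 => by
    rw [hT i h1 h2]
    exact mul_ne_zero (pow_ne_zero _ hA_ne) (hS' i h1 h2)
  have hw_prod : ∀ i, 1 ≤ i → i ≤ n - 1 → w i * wb i = x i * xb i := fun i h1 h2 => by
    have key : w i * wb i = A' ^ 2 * (y (n-i) * yb (n-i)) := by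
      rcases eq_or_lt_of_le h2 with rfl | h
      · rw [hwn1, hwbn1, show n - (n - 1) = 1 by omega]
        exact div_mul_mul_div_cancel_middle hy0_ne hT0_ne
      · rw [hwi i h1 (by omega), hwbi i h1 (by omega)]
        exact div_mul_mul_div_cancel_middle (hyi_ne _ (by omega) (by omega))
          (hT_ne i h1 (by omega))
    rw [key, hprod (n-i) (by omega) (by omega), show n - (n - i) = i by omega, hA'_inv]
    field_simp
  have hw : ∀ i, i ≤ n → w i = x i := fun i h => by
    rcases Nat.eq_zero_or_pos i with rfl | h1
    · rw [hw0, hyn, hA'_inv]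
      field_simp
    rcases eq_or_lt_of_le h with rfl | h2
    · rw [hwn, hy0, hA'_inv]
      field_simp
    rcases eq_or_lt_of_le (show i ≤ n - 1 by omega) with rfl | h3
    · exact hw_n1
    · exact hw_i i h1 (by omega)
  refine ⟨mul_ne_zero hxn1 hxn, hx0, hS0, fun i h1 h2 => ⟨hx_ne _ (by omega), hS i h1 h2⟩,
    mul_ne_zero hyn1_ne hyn_ne, hy0_ne, hT0_ne,
    fun i h1 h2 => ⟨hyi_ne _ (by omega) (by omega), hT_ne i h1 h2⟩, hw, fun i h1 h2 => ?_⟩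
  have h := hw_prod i h1 h2
  rw [hw i (by omega)] at h
  exact mul_left_cancel₀ (hx_ne i (by omega)) h
end
end

section
/- Fix n ≥ 2 and let F be the field of rational functions over ℚ in the 2n indeterminates x_0, x_1, …, x_n, x̄_{n−1}, …, x̄_1. For a tuple z = (z_0, z_1, …, z_n, z̄_{n−1}, …, z̄_1) of nonzero elements of F set A(z) = (z_{n−1}z̄_{n−1} + z_n²)/(z_{n−1}z_n²) and define σ̄(z) = (y_0, y_1, …, y_n, ȳ_{n−1}, …, ȳ_1) by: y_0 = z_n·A(z); y_i = A(z)·(z_{n−i−1}z̄_{n−i−1} + z_{n−i}z̄_{n−i})/z_{n−i−1} for 1 ≤ i ≤ n−2; y_{n−1} = A(z)·(z_0² + z_1z̄_1)/z_0²; y_n = z_0·A(z); ȳ_i = A(z)·z_{n−i−1}z_{n−i}z̄_{n−i}/(z_{n−i−1}z̄_{n−i−1} + z_{n−i}z̄_{n−i}) for 1 ≤ i ≤ n−2; ȳ_{n−1} = A(z)·z_0²z_1z̄_1/(z_0² + z_1z̄_1). Then for the tuple x of indeterminates, all denominators occurring are nonzero and σ̄(σ̄(x)) = x; in particular σ̄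 is a birational involution. -/
noncomputable section

/-- The index set of the `2n` indeterminates `x_0, x_1, …, x_n, x̄_1, …, x̄_{n-1}`. -/
abbrev Vars5 (n : ℕ) : Type := Fin (n + 1) ⊕ Fin (n - 1)

/-- The field of rational functions over `ℚ` in the indeterminates
`x_0, x_1, …, x_n, x̄_{n-1}, …, x̄_1`. -/
abbrev F5 (n : ℕ) : Type := FractionRing (MvPolynomial (Vars5 n) ℚ)

/-- A polynomial whose value at some point is nonzero is nonzero in the fraction field. -/
theorem algebraMap_ne_zero_of_eval_ne_zero {σ : Type*} (v : σ → ℚ) {P : MvPolynomial σ ℚ}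
    (h : MvPolynomial.eval v P ≠ 0) :
    algebraMap (MvPolynomial σ ℚ) (FractionRing (MvPolynomial σ ℚ)) P ≠ 0 := by
  rw [Ne, FaithfulSMul.algebraMap_eq_zero_iff]
  rintro rfl
  exact h (map_zero _)

/-- The birational map `σ̄` used in the construction of the affine geometric crystal
`V(D_{n+1}^{(2)})` is an involution: all denominators occurring are nonzero and
`σ̄(σ̄(x)) = x`.  Here `(y, ȳ) = σ̄(x, x̄)` and `(w, w̄) = σ̄(y, ȳ)` are given by the
same formulas, with `A = A(x)` and `A' = A(y)` the respective factors. -/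
theorem stmt5 (n : ℕ) (hn : 2 ≤ n)
    (x xb : ℕ → F5 n)
    (hx : ∀ i (h : i ≤ n),
      x i = algebraMap (MvPolynomial (Vars5 n) ℚ) (F5 n)
        (MvPolynomial.X (Sum.inl ⟨i, by omega⟩)))
    (hxb : ∀ i (h1 : 1 ≤ i) (h2 : i ≤ n - 1),
      xb i = algebraMap (MvPolynomial (Vars5 n) ℚ) (F5 n)
        (MvPolynomial.X (Sum.inr ⟨i - 1, by omega⟩)))
    (A : F5 n) (hA : A = (x (n-1) * xb (n-1) + x n ^ 2) / (x (n-1) * x n ^ 2))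
    (y yb : ℕ → F5 n)
    (hy0 : y 0 = x n * A)
    (hyi : ∀ i, 1 ≤ i → i ≤ n - 2 →
      y i = A * (x (n-i-1) * xb (n-i-1) + x (n-i) * xb (n-i)) / x (n-i-1))
    (hyn1 : y (n-1) = A * (x 0 ^ 2 + x 1 * xb 1) / x 0 ^ 2)
    (hyn : y n = x 0 * A)
    (hybi : ∀ i, 1 ≤ i → i ≤ n - 2 →
      yb i = A * (x (n-i-1) * x (n-i) * xb (n-i))
        / (x (n-i-1) * xb (n-i-1) + x (n-i) * xb (n-i)))
    (hybn1 : yb (n-1) = A * (x 0 ^ 2 * x 1 * xb 1) / (x 0 ^ 2 + x 1 * xb 1))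
    (A' : F5 n) (hA' : A' = (y (n-1) * yb (n-1) + y n ^ 2) / (y (n-1) * y n ^ 2))
    (w wb : ℕ → F5 n)
    (hw0 : w 0 = y n * A')
    (hwi : ∀ i, 1 ≤ i → i ≤ n - 2 →
      w i = A' * (y (n-i-1) * yb (n-i-1) + y (n-i) * yb (n-i)) / y (n-i-1))
    (hwn1 : w (n-1) = A' * (y 0 ^ 2 + y 1 * yb 1) / y 0 ^ 2)
    (hwn : w n = y 0 * A')
    (hwbi : ∀ i, 1 ≤ i → i ≤ n - 2 →
      wb i = A' * (y (n-i-1) * y (n-i) * yb (n-i))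
        / (y (n-i-1) * yb (n-i-1) + y (n-i) * yb (n-i)))
    (hwbn1 : wb (n-1) = A' * (y 0 ^ 2 * y 1 * yb 1) / (y 0 ^ 2 + y 1 * yb 1)) :
    x (n-1) * x n ^ 2 ≠ 0 ∧ x 0 ^ 2 ≠ 0 ∧ x 0 ^ 2 + x 1 * xb 1 ≠ 0 ∧
    (∀ i, 1 ≤ i → i ≤ n - 2 →
      x (n-i-1) ≠ 0 ∧ x (n-i-1) * xb (n-i-1) + x (n-i) * xb (n-i) ≠ 0) ∧
    y (n-1) * y n ^ 2 ≠ 0 ∧ y 0 ^ 2 ≠ 0 ∧ y 0 ^ 2 + y 1 * yb 1 ≠ 0 ∧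
    (∀ i, 1 ≤ i → i ≤ n - 2 →
      y (n-i-1) ≠ 0 ∧ y (n-i-1) * yb (n-i-1) + y (n-i) * yb (n-i) ≠ 0) ∧
    (∀ i, i ≤ n → w i = x i) ∧
    (∀ i, 1 ≤ i → i ≤ n - 1 → wb i = xb i) := by
  have x_ne : ∀ i, i ≤ n → x i ≠ 0 := fun i h => by
    rw [hx i h]
    exact algebraMap_ne_zero_of_eval_ne_zero 1 (by simp)
  have xb_ne : ∀ i, 1 ≤ i → i ≤ n - 1 → xb i ≠ 0 := fun i h1 h2 => by
    rw [hxb i h1 h2]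
    exact algebraMap_ne_zero_of_eval_ne_zero 1 (by simp)
  have first_ne : x 0 ^ 2 + x 1 * xb 1 ≠ 0 := by
    rw [hx 0 (by omega), hx 1 (by omega), hxb 1 le_rfl (by omega), ← map_pow, ← map_mul,
      ← map_add]
    exact algebraMap_ne_zero_of_eval_ne_zero 1 (by norm_num)
  have last_ne : x (n-1) * xb (n-1) + x n ^ 2 ≠ 0 := by
    rw [hx (n-1) (by omega), hx n le_rfl, hxb (n-1) (by omega) le_rfl, ← map_pow, ← map_mul,
      ← map_add]
    exact algebraMap_ne_zero_of_eval_ne_zero 1 (by norm_num)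
  have mid_ne : ∀ i, 1 ≤ i → i ≤ n - 2 → x i * xb i + x (i+1) * xb (i+1) ≠ 0 :=
    fun i h1 h2 => by
    rw [hx i (by omega), hx (i+1) (by omega), hxb i h1 (by omega),
      hxb (i+1) (by omega) (by omega), ← map_mul, ← map_mul, ← map_add]
    exact algebraMap_ne_zero_of_eval_ne_zero 1 (by norm_num)
  have x0 := x_ne 0 (by omega)
  have xn := x_ne n le_rfl
  have xn1 := x_ne (n-1) (by omega)
  have A_ne : A ≠ 0 := by
    rw [hA]
    exact div_ne_zero last_ne (mul_ne_zero xn1 (pow_ne_zero 2 xn))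
  -- `y` in terms of the reflected index
  have y_eq : ∀ i, 1 ≤ i → i ≤ n - 2 →
      y (n-i-1) = A * (x i * xb i + x (i+1) * xb (i+1)) / x i := fun i h1 h2 => by
    have h := hyi (n-i-1) (by omega) (by omega)
    rwa [show n - (n-i-1) - 1 = i by omega, show n - (n-i-1) = i + 1 by omega] at h
  have y_mul_yb : ∀ i, 1 ≤ i → i ≤ n - 1 → y (n-i) * yb (n-i) = A ^ 2 * (x i * xb i) :=
    fun i h1 h2 => by
    rcases Nat.lt_or_ge 1 i with h | h
    · have e1 := hyi (n-i) (by omega) (by omega)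
      have e2 := hybi (n-i) (by omega) (by omega)
      have m := mid_ne (i-1) (by omega) (by omega)
      have k := x_ne (i-1) (by omega)
      rw [show n - (n-i) - 1 = i - 1 by omega, show n - (n-i) = i by omega] at e1 e2
      rw [show i - 1 + 1 = i by omega] at m
      rw [e1, e2]
      field_simp
    · obtain rfl : i = 1 := by omega
      rw [hyn1, hybn1]
      field_simp
  have y0_ne : y 0 ≠ 0 := hy0 ▸ mul_ne_zero xn A_ne
  have yn_ne : y n ≠ 0 := hyn ▸ mul_ne_zero x0 A_ne
  have yn1_ne : y (n-1) ≠ 0 := by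
    rw [hyn1]
    exact div_ne_zero (mul_ne_zero A_ne first_ne) (pow_ne_zero 2 x0)
  have y_ne : ∀ i, 1 ≤ i → i ≤ n - 2 → y (n-i-1) ≠ 0 := fun i h1 h2 => by
    rw [y_eq i h1 h2]
    exact div_ne_zero (mul_ne_zero A_ne (mid_ne i h1 h2)) (x_ne i (by omega))
  have y_first : y 0 ^ 2 + y 1 * yb 1 = A ^ 2 * (x (n-1) * xb (n-1) + x n ^ 2) := by
    have h := y_mul_yb (n-1) (by omega) le_rfl
    rw [show n - (n-1) = 1 by omega] at h
    rw [h, hy0]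
    ring
  have y_mid : ∀ i, 1 ≤ i → i ≤ n - 2 → y (n-i-1) * yb (n-i-1) + y (n-i) * yb (n-i) =
      A ^ 2 * (x i * xb i + x (i+1) * xb (i+1)) := fun i h1 h2 => by
    rw [y_mul_yb i h1 (by omega), Nat.sub_sub, y_mul_yb (i+1) (by omega) (by omega)]
    ring
  have A'_eq : A' = A⁻¹ := by
    rw [hA', y_mul_yb 1 le_rfl (by omega), hyn1, hyn]
    field_simp
    ring
  have A2_ne := pow_ne_zero 2 A_ne
  refine ⟨mul_ne_zero xn1 (pow_ne_zero 2 xn), pow_ne_zero 2 x0, first_ne, fun i h1 h2 =>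
    ⟨x_ne _ (by omega), ?_⟩, mul_ne_zero yn1_ne (pow_ne_zero 2 yn_ne), pow_ne_zero 2 y0_ne,
    y_first ▸ mul_ne_zero A2_ne last_ne, fun i h1 h2 => ⟨y_ne i h1 h2,
    y_mid i h1 h2 ▸ mul_ne_zero A2_ne (mid_ne i h1 h2)⟩, fun i h => ?_, fun i h1 h2 => ?_⟩
  · have m := mid_ne (n-i-1) (by omega) (by omega)
    rwa [show n - i - 1 + 1 = n - i by omega] at m
  · obtain rfl | rfl | rfl | ⟨h1, h2⟩ :
        i = 0 ∨ i = n ∨ i = n - 1 ∨ (1 ≤ i ∧ i ≤ n - 2) := by omega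
    · rw [hw0, hyn, A'_eq]
      field_simp
    · rw [hwn, hy0, A'_eq]
      field_simp
    · rw [hwn1, y_first, A'_eq, hy0]
      field_simp
      rw [hA]
      field_simp
    · have m := mid_ne i h1 h2
      have k := x_ne i h
      rw [hwi i h1 h2, y_mid i h1 h2, A'_eq, y_eq i h1 h2]
      field_simp
  · obtain rfl | h : i = n - 1 ∨ i ≤ n - 2 := by omega
    · have e := y_mul_yb (n-1) h1 le_rfl
      rw [show n - (n-1) = 1 by omega] at e
      rw [hwbn1, y_first, A'_eq, mul_assoc (y 0 ^ 2), e, hy0]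
      field_simp
      rw [hA]
      field_simp
    · have m := mid_ne i h1 h
      have k := x_ne i (by omega)
      rw [hwbi i h1 h, y_mid i h1 h, A'_eq, mul_assoc (y (n-i-1)), y_mul_yb i h1 h2,
        y_eq i h1 h]
      field_simp
end
end

section
/- Fix n ≥ 2 and let K be a field. Let A = (a_{ij})_{0 ≤ i,j ≤ n} be the A_n^{(1)} Cartan matrix: a_{ij} = 2 if i = j, a_{ij} = −1 if i ≡ j ± 1 (mod n+1) and i ≠ j, and a_{ij} = 0 otherwise. On (Kˣ)^n define, for c ∈ Kˣ: e_i^c(x_1,…,x_n) = (x_1,…,c·x_i,…,x_n) for 1 ≤ i ≤ n, and e_0^c(x_1,…,x_n) = (x_1/c, …, x_n/c); define γ_1(x) = x_1²/x_2, γ_i(x) = x_i²/(x_{i−1}x_{i+1}) for 2 ≤ i ≤ n−1, γ_n(x) = x_n²/x_{n−1}, γ_0(x) = 1/(x_1x_n); and ε_i(x) = x_{i+1}/x_i for 1 ≤ i ≤ n−1, ε_n(x) = 1/x_n, ε_0(x) = x_1. Then for all x ∈ (Kˣ)^n, c, c₁, c₂ ∈ Kˣ and all i, j ∈ {0,…,n}: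 (1) γ_j(e_i^c(x)) = c^{a_{ij}}·γ_j(x); (2) ε_i(e_i^c(x)) = c^{−1}·ε_i(x); (3) if a_{ij} = a_{ji} = −1 then e_i^{c₁}e_j^{c₁c₂}e_i^{c₂}(x) = e_j^{c₂}e_i^{c₁c₂}e_j^{c₁}(x); and (4) if a_{ij} = 0 then e_i^{c₁}e_j^{c₂}(x) = e_j^{c₂}e_i^{c₁}(x). -/
/-- The geometric crystal axioms (ii)–(iv) of Definition 2.2, including the Verma
relations, for the explicit data of the affine geometric crystal `V(A_n^{(1)})`:
on `(Kˣ)^n` (coordinates `x 1, …, x n`), `e_i^c` multiplies the `i`-th coordinate by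
`c` (`1 ≤ i ≤ n`) and `e_0^c` divides every coordinate by `c`; `a` is the `A_n^{(1)}`
Cartan matrix. -/
theorem stmt7 (n : ℕ) (hn : 2 ≤ n) (K : Type*) [Field K]
    (a : ℕ → ℕ → ℤ)
    (ha : ∀ i ≤ n, ∀ j ≤ n, a i j =
      if i = j then 2
      else if (i + 1) % (n + 1) = j ∨ (j + 1) % (n + 1) = i then -1
      else 0)
    (e : ℕ → Kˣ → (ℕ → Kˣ) → (ℕ → Kˣ))
    (he : ∀ i, 1 ≤ i → i ≤ n → ∀ (c : Kˣ) (x : ℕ → Kˣ) (j : ℕ),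
      e i c x j = if j = i then c * x i else x j)
    (he0 : ∀ (c : Kˣ) (x : ℕ → Kˣ) (j : ℕ), e 0 c x j = x j / c)
    (gam : ℕ → (ℕ → Kˣ) → Kˣ)
    (hgam0 : ∀ x, gam 0 x = 1 / (x 1 * x n))
    (hgam1 : ∀ x, gam 1 x = x 1 ^ 2 / x 2)
    (hgammid : ∀ i, 2 ≤ i → i ≤ n - 1 → ∀ x, gam i x = x i ^ 2 / (x (i-1) * x (i+1)))
    (hgamn : ∀ x, gam n x = x n ^ 2 / x (n-1))
    (eps : ℕ → (ℕ → Kˣ) → Kˣ)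
    (heps0 : ∀ x, eps 0 x = x 1)
    (hepsmid : ∀ i, 1 ≤ i → i ≤ n - 1 → ∀ x, eps i x = x (i+1) / x i)
    (hepsn : ∀ x, eps n x = 1 / x n) :
    ∀ (x : ℕ → Kˣ) (c c₁ c₂ : Kˣ), ∀ i ≤ n, ∀ j ≤ n,
      (gam j (e i c x) = c ^ (a i j) * gam j x) ∧
      (eps i (e i c x) = c⁻¹ * eps i x) ∧
      (a i j = -1 ∧ a j i = -1 →
        e i c₁ (e j (c₁ * c₂) (e i c₂ x)) = e j c₂ (e i (c₁ * c₂) (e j c₁ x))) ∧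
      (a i j = 0 → e i c₁ (e j c₂ x) = e j c₂ (e i c₁ x)) := by
  have hval : ∀ i ≤ n, ∀ j ≤ n,
      (i = j ∧ a i j = 2) ∨
      (i ≠ j ∧ (j = i + 1 ∨ i = j + 1 ∨ (i = n ∧ j = 0) ∨ (j = n ∧ i = 0)) ∧ a i j = -1) ∨
      (i ≠ j ∧ ¬(j = i + 1 ∨ i = j + 1 ∨ (i = n ∧ j = 0) ∨ (j = n ∧ i = 0)) ∧ a i j = 0) := by
    have hmod : ∀ i ≤ n, ∀ j ≤ n, (i + 1) % (n + 1) = j ↔ j = i + 1 ∨ (i = n ∧ j = 0) := by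
      intro i hi j hj
      rcases hi.eq_or_lt with rfl | h
      · rw [Nat.mod_self]
        omega
      · rw [Nat.mod_eq_of_lt (by omega)]
        omega
    intro i hi j hj
    have h₁ := hmod i hi j hj
    have h₂ := hmod j hj i hi
    rw [ha i hi j hj]
    generalize (i + 1) % (n + 1) = p at *
    generalize (j + 1) % (n + 1) = q at *
    split_ifs <;> omega
  intro x c c₁ c₂ i hi j hj
  refine ⟨?_, ?_, ?_, ?_⟩
  · have hv := hval i hi j hj
    rcases Nat.eq_zero_or_pos i with rfl | hi0
    · have hj' : j = 0 ∨ j = 1 ∨ j = n ∨ (2 ≤ j ∧ j ≤ n - 1) := by omega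
      rcases hj' with rfl | rfl | rfl | ⟨h2, h3⟩
      · simp only [hgam0, he0]
        rcases hv with ⟨hij, h⟩ | ⟨hij, hadj, h⟩ | ⟨hij, hadj, h⟩ <;> rw [h] <;>
          first | omega | (ext; simp; field_simp)
      · simp only [hgam1, he0]
        rcases hv with ⟨hij, h⟩ | ⟨hij, hadj, h⟩ | ⟨hij, hadj, h⟩ <;> rw [h] <;>
          first | omega | (ext; simp; field_simp)
      · simp only [hgamn, he0]
        rcases hv with ⟨hij, h⟩ | ⟨hij, hadj, h⟩ | ⟨hij, hadj, h⟩ <;> rw [h] <;>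
          first | omega | (ext; simp; field_simp)
      · simp only [hgammid j h2 h3, he0]
        rcases hv with ⟨hij, h⟩ | ⟨hij, hadj, h⟩ | ⟨hij, hadj, h⟩ <;> rw [h] <;>
          first | omega | (ext; simp; field_simp)
    · have hj' : j = 0 ∨ j = 1 ∨ j = n ∨ (2 ≤ j ∧ j ≤ n - 1) := by omega
      rcases hj' with rfl | rfl | rfl | ⟨h2, h3⟩
      · simp only [hgam0, he i hi0 hi]
        rcases hv with ⟨hij, h⟩ | ⟨hij, hadj, h⟩ | ⟨hij, hadj, h⟩ <;> rw [h] <;>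
          split_ifs <;> first
            | omega
            | (subst_vars; ext; simp; done)
            | (subst_vars; ext; simp; field_simp)
      · simp only [hgam1, he i hi0 hi]
        rcases hv with ⟨hij, h⟩ | ⟨hij, hadj, h⟩ | ⟨hij, hadj, h⟩ <;> rw [h] <;>
          split_ifs <;> first
            | omega
            | (subst_vars; ext; simp; done)
            | (subst_vars; ext; simp; field_simp)
      · simp only [hgamn, he i hi0 hi]
        rcases hv with ⟨hij, h⟩ | ⟨hij, hadj, h⟩ | ⟨hij, hadj, h⟩ <;> rw [h] <;>
          split_ifs <;> first
            | omega
            | (subst_vars; ext; simp; done)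
            | (subst_vars; ext; simp; field_simp)
      · simp only [hgammid j h2 h3, he i hi0 hi]
        rcases hv with ⟨hij, h⟩ | ⟨hij, hadj, h⟩ | ⟨hij, hadj, h⟩ <;> rw [h] <;>
          split_ifs <;> first
            | omega
            | (subst_vars; ext; simp; done)
            | (subst_vars; ext; simp; field_simp)
  · have hi' : i = 0 ∨ i = n ∨ (1 ≤ i ∧ i ≤ n - 1) := by omega
    rcases hi' with rfl | rfl | ⟨h1, h2⟩
    · simp only [heps0, he0]
      rw [div_eq_inv_mul]
    · simp only [hepsn, he i (by omega) le_rfl, if_true]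
      ext
      simp
      field_simp
    · simp only [hepsmid i h1 h2, he i h1 hi, if_true]
      rw [if_neg (by omega)]
      ext
      simp
      field_simp
  · rintro -
    funext k
    rcases Nat.eq_zero_or_pos i with rfl | hi0 <;> rcases Nat.eq_zero_or_pos j with rfl | hj0
    · simp only [he0]
      ext
      simp
      field_simp
    · simp only [he0, he j hj0 hj]
      split_ifs <;> (ext; simp; try field_simp)
    · simp only [he0, he i hi0 hi]
      split_ifs <;> (ext; simp; try field_simp)
    · simp only [he i hi0 hi, he j hj0 hj]
      split_ifs <;> first
        | omega
        | (subst_vars; ext; simp; done)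
        | (subst_vars; ext; simp; ring)
  · rintro -
    funext k
    rcases Nat.eq_zero_or_pos i with rfl | hi0 <;> rcases Nat.eq_zero_or_pos j with rfl | hj0
    · simp only [he0]
      rw [div_right_comm]
    · simp only [he0, he j hj0 hj]
      split_ifs <;> (ext; simp; try field_simp)
    · simp only [he0, he i hi0 hi]
      split_ifs <;> (ext; simp; try field_simp)
    · simp only [he i hi0 hi, he j hj0 hj]
      split_ifs <;> first
        | omega
        | (subst_vars; ext; simp; done)
        | (subst_vars; ext; simp; ring)
end

section
/- Fix n ≥ 2, let F be the field of rational functions over ℚ in the indeterminates x_0, x_1, …, x_n, x̄_{n−1}, …, x̄_1, set A(x) = (x_{n−1}x̄_{n−1} + x_n)/(x_{n−1}x_n), and let σ̄(x) = (y_0, y_1, …, y_n, ȳ_{n−1}, …, ȳ_1) be given by y_0 = x_n·A(x)², y_i = A(x)(x_{n−i−1}x̄_{n−i−1} + x_{n−i}x̄_{n−i})/x_{n−i−1} (1 ≤ i ≤ n−2), y_{n−1} = A(x)(x_0 + x_1x̄_1)/x_0, y_n = x_0·A(x)², ȳ_i = A(x)·x_{n−i−1}x_{n−i}x̄_{n−i}/(x_{n−i−1}x̄_{n−i−1}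 + x_{n−i}x̄_{n−i}) (1 ≤ i ≤ n−2), ȳ_{n−1} = A(x)·x_0x_1x̄_1/(x_0 + x_1x̄_1). Then: (1) y_i·ȳ_i = A(x)²·x_{n−i}·x̄_{n−i} for all 1 ≤ i ≤ n−1; (2) y_0 = A(x)²·x_n and y_n = A(x)²·x_0; and (3) A(σ̄(x)) = 1/A(x), i.e. (y_{n−1}ȳ_{n−1} + y_n)/(y_{n−1}y_n) = 1/A(x). -/
noncomputable section

/-- The index set of the `2n` indeterminates `x_0, x_1, …, x_n, x̄_1, …, x̄_{n-1}`. -/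
abbrev Vars11 (n : ℕ) : Type := Fin (n + 1) ⊕ Fin (n - 1)

/-- The field of rational functions over `ℚ` in the indeterminates
`x_0, x_1, …, x_n, x̄_{n-1}, …, x̄_1`. -/
abbrev F11 (n : ℕ) : Type := FractionRing (MvPolynomial (Vars11 n) ℚ)

open MvPolynomial in
/-- A polynomial that does not vanish at the all-ones point is nonzero in the fraction field. -/
theorem algebraMap_ne_zero_of_eval_one {σ : Type*} {p : MvPolynomial σ ℚ}
    (h : eval (fun _ => 1) p ≠ 0) :
    algebraMap (MvPolynomial σ ℚ) (FractionRing (MvPolynomial σ ℚ)) p ≠ 0 := by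
  intro h0
  rw [FaithfulSMul.algebraMap_eq_zero_iff] at h0
  simp [h0] at h

/-- The key auxiliary identities (u1), (u2) for the birational involution `σ̄` of
`V(C_n^{(1)})`: (1) `y_iȳ_i = A(x)²x_{n−i}x̄_{n−i}` for `1 ≤ i ≤ n−1`;
(2) `y_0 = A(x)²x_n` and `y_n = A(x)²x_0`; (3) `A(σ̄(x)) = 1/A(x)`. -/
theorem stmt11 (n : ℕ) (hn : 2 ≤ n)
    (x xb : ℕ → F11 n)
    (hx : ∀ i (h : i ≤ n),
      x i = algebraMap (MvPolynomial (Vars11 n) ℚ) (F11 n)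
        (MvPolynomial.X (Sum.inl ⟨i, by omega⟩)))
    (hxb : ∀ i (h1 : 1 ≤ i) (h2 : i ≤ n - 1),
      xb i = algebraMap (MvPolynomial (Vars11 n) ℚ) (F11 n)
        (MvPolynomial.X (Sum.inr ⟨i - 1, by omega⟩)))
    (A : F11 n) (hA : A = (x (n-1) * xb (n-1) + x n) / (x (n-1) * x n))
    (y yb : ℕ → F11 n)
    (hy0 : y 0 = x n * A ^ 2)
    (hyi : ∀ i, 1 ≤ i → i ≤ n - 2 →
      y i = A * (x (n-i-1) * xb (n-i-1) + x (n-i) * xb (n-i)) / x (n-i-1))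
    (hyn1 : y (n-1) = A * (x 0 + x 1 * xb 1) / x 0)
    (hyn : y n = x 0 * A ^ 2)
    (hybi : ∀ i, 1 ≤ i → i ≤ n - 2 →
      yb i = A * (x (n-i-1) * x (n-i) * xb (n-i))
        / (x (n-i-1) * xb (n-i-1) + x (n-i) * xb (n-i)))
    (hybn1 : yb (n-1) = A * (x 0 * x 1 * xb 1) / (x 0 + x 1 * xb 1)) :
    (∀ i, 1 ≤ i → i ≤ n - 1 → y i * yb i = A ^ 2 * (x (n-i) * xb (n-i))) ∧
    y 0 = A ^ 2 * x n ∧ y n = A ^ 2 * x 0 ∧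
    (y (n-1) * yb (n-1) + y n) / (y (n-1) * y n) = 1 / A := by
  have hx_ne : ∀ i, i ≤ n → x i ≠ 0 := by
    intro i hi
    rw [hx i hi]
    exact algebraMap_ne_zero_of_eval_one (by simp)
  have hsum_ne : ∀ i, 1 ≤ i → i ≤ n - 2 →
      x (n-i-1) * xb (n-i-1) + x (n-i) * xb (n-i) ≠ 0 := by
    intro i h1 h2
    rw [hx (n-i-1) (by omega), hx (n-i) (by omega), hxb (n-i-1) (by omega) (by omega),
      hxb (n-i) (by omega) (by omega), ← map_mul, ← map_mul, ← map_add]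
    exact algebraMap_ne_zero_of_eval_one (by simp)
  have hx0 := hx_ne 0 (by omega)
  have hfirst_ne : x 0 + x 1 * xb 1 ≠ 0 := by
    rw [hx 0 (by omega), hx 1 (by omega), hxb 1 le_rfl (by omega), ← map_mul, ← map_add]
    exact algebraMap_ne_zero_of_eval_one (by simp)
  have hA_ne : A ≠ 0 := by
    rw [hA]
    refine div_ne_zero ?_ (mul_ne_zero (hx_ne _ (by omega)) (hx_ne _ le_rfl))
    rw [hx (n-1) (by omega), hx n le_rfl, hxb (n-1) (by omega) le_rfl, ← map_mul, ← map_add]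
    exact algebraMap_ne_zero_of_eval_one (by simp)
  have hlast : y (n-1) * yb (n-1) = A ^ 2 * (x 1 * xb 1) := by
    rw [hyn1, hybn1]
    field_simp
  refine ⟨fun i h1 h2 => ?_, by rw [hy0, mul_comm], by rw [hyn, mul_comm], ?_⟩
  · rcases Nat.lt_or_ge (n - 2) i with h | h
    · obtain rfl : i = n - 1 := by omega
      rw [hlast, show n - (n - 1) = 1 by omega]
    · have hx' := hx_ne (n-i-1) (by omega)
      have hs := hsum_ne i h1 h
      rw [hyi i h1 h, hybi i h1 h]
      field_simp
  · rw [hlast, hyn1, hyn]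
    field_simp
    ring
end
end

section
/- For every n ≥ 2 the map μ : ℤ^n → B, μ(x_1,…,x_n) = (x_1, x_2−x_1, …, x_n−x_{n−1}, −x_n), is a bijection onto B = {b ∈ ℤ^{n+1} : b_1+⋯+b_{n+1} = 0}, and for every x ∈ ℤ^n and every i ∈ {0,1,…,n}: μ(ẽ_i(x)) = ẽ_i(μ(x)), wt_i(μ(x)) = wt_i(x), and ε_i(μ(x)) = ε_i(x). (Thus the ultra-discretization UD(V(A_n^{(1)})) is isomorphic to the limit of perfect crystals B_∞(A_n^{(1)}).) -/
namespace Stmt12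

/-- Source: `UD(V(A_n^{(1)}))` is `ℤ^n`, realized as integer sequences supported on
the coordinates `1, …, n`. -/
def S (n : ℕ) : Set (ℕ → ℤ) := {x | ∀ j, j = 0 ∨ n < j → x j = 0}

/-- Target: the limit of perfect crystals `B_∞(A_n^{(1)})`, the set of
`(b_1, …, b_{n+1}) ∈ ℤ^{n+1}` with `b_1 + ⋯ + b_{n+1} = 0`. -/
def B (n : ℕ) : Set (ℕ → ℤ) :=
  {b | (∀ j, j = 0 ∨ n + 1 < j → b j = 0) ∧ ∑ j ∈ Finset.Icc 1 (n + 1), b j = 0}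

/-- `μ(x_1,…,x_n) = (x_1, x_2 − x_1, …, x_n − x_{n−1}, −x_n)`. -/
def μ (n : ℕ) (x : ℕ → ℤ) : ℕ → ℤ := fun j =>
  if j = 1 then x 1
  else if 2 ≤ j ∧ j ≤ n then x j - x (j - 1)
  else if j = n + 1 then - x n
  else 0

/-- Source crystal operators: `ẽ_0` subtracts 1 from every coordinate; `ẽ_i`
(`1 ≤ i ≤ n`) adds 1 to `x_i`. -/
def eS (n i : ℕ) (x : ℕ → ℤ) : ℕ → ℤ := fun j =>
  if i = 0 then (if 1 ≤ j ∧ j ≤ n then x j - 1 else x j)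
  else if j = i then x j + 1 else x j

/-- Target crystal operators on `B_∞(A_n^{(1)})`. -/
def eB (n i : ℕ) (b : ℕ → ℤ) : ℕ → ℤ := fun j =>
  if i = 0 then (if j = 1 then b 1 - 1 else if j = n + 1 then b (n + 1) + 1 else b j)
  else if j = i then b i + 1
  else if j = i + 1 then b (i + 1) - 1
  else b j

/-- Source weights. -/
def wtS (n i : ℕ) (x : ℕ → ℤ) : ℤ :=
  if i = 0 then - x 1 - x n
  else if i = 1 then 2 * x 1 - x 2
  else if i = n then 2 * x n - x (n - 1)
  else - x (i - 1) + 2 * x i - x (i + 1)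

/-- Target weights. -/
def wtB (n i : ℕ) (b : ℕ → ℤ) : ℤ :=
  if i = 0 then b (n + 1) - b 1 else b i - b (i + 1)

/-- Source `ε`-functions. -/
def epsS (n i : ℕ) (x : ℕ → ℤ) : ℤ :=
  if i = 0 then x 1
  else if i = n then - x n
  else x (i + 1) - x i

/-- Target `ε`-functions. -/
def epsB (n i : ℕ) (b : ℕ → ℤ) : ℤ :=
  if i = 0 then b 1 else b (i + 1)

theorem μ_apply {n : ℕ} {x : ℕ → ℤ} (hx : x ∈ S n) (j : ℕ) : μ n x j = x j - x (j - 1) := by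
  have h0 : x 0 = 0 := hx 0 (Or.inl rfl)
  unfold μ
  split_ifs with h1 h2 h3
  · subst h1; simp [h0]
  · rfl
  · subst h3; simp [hx (n + 1) (Or.inr n.lt_succ_self)]
  · obtain rfl | hj : j = 0 ∨ n + 1 < j := by omega
    · simp
    · rw [hx j (Or.inr (by omega)), hx (j - 1) (Or.inr (by omega)), sub_zero]

theorem sum_Icc_μ {n : ℕ} {x : ℕ → ℤ} (hx : x ∈ S n) (k : ℕ) :
    ∑ j ∈ Finset.Icc 1 k, μ n x j = x k := by
  induction k with
  | zero => simp [hx 0 (Or.inl rfl)]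
  | succ k ih =>
    rw [Finset.sum_Icc_succ_top (by omega), ih, μ_apply hx, Nat.add_sub_cancel]
    ring

theorem eS_mem {n i : ℕ} (hi : i ≤ n) {x : ℕ → ℤ} (hx : x ∈ S n) : eS n i x ∈ S n := by
  intro j hj
  have h := hx j hj
  unfold eS
  split_ifs <;> omega

theorem bijOn_μ (n : ℕ) : Set.BijOn (μ n) (S n) (B n) := by
  refine ⟨fun x hx => ⟨fun j hj => ?_, ?_⟩, fun x hx y hy hxy => ?_, fun b hb => ?_⟩
  · rw [μ_apply hx, hx j (by omega), hx (j - 1) (by omega), sub_zero]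
  · rw [sum_Icc_μ hx, hx (n + 1) (Or.inr n.lt_succ_self)]
  · funext k
    rw [← sum_Icc_μ hx, ← sum_Icc_μ hy, hxy]
  · obtain ⟨hb0, hsum⟩ := hb
    have hvanish : ∀ k, n < k → ∑ j ∈ Finset.Icc 1 k, b j = 0 := by
      intro k hk
      induction k, hk using Nat.le_induction with
      | base => exact hsum
      | succ k hk ih =>
        rw [Finset.sum_Icc_succ_top (by omega), ih, hb0 (k + 1) (by omega), add_zero]
    have hx : (fun k => ∑ j ∈ Finset.Icc 1 k, b j) ∈ S n := by
      rintro j (rfl | hj)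
      · simp
      · exact hvanish j hj
    refine ⟨_, hx, ?_⟩
    funext j
    rw [μ_apply hx]
    cases j with
    | zero => simp [hb0 0 (Or.inl rfl)]
    | succ j => simp [Finset.sum_Icc_succ_top]

theorem μ_eS {n i : ℕ} (hn : 1 ≤ n) (hi : i ≤ n) {x : ℕ → ℤ} (hx : x ∈ S n) :
    μ n (eS n i x) = eB n i (μ n x) := by
  funext j
  rw [μ_apply (eS_mem hi hx)]
  unfold eB
  simp only [μ_apply hx]
  unfold eS
  grind

/-- `μ` is a bijection of `ℤ^n` onto `B_∞(A_n^{(1)})` commuting with the crystal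
operators and preserving `wt_i` and `ε_i`; hence
`UD(V(A_n^{(1)})) ≅ B_∞(A_n^{(1)})`. -/
theorem stmt12 (n : ℕ) (hn : 2 ≤ n) :
    Set.BijOn (μ n) (S n) (B n) ∧
    ∀ x ∈ S n, ∀ i ≤ n,
      μ n (eS n i x) = eB n i (μ n x) ∧
      wtB n i (μ n x) = wtS n i x ∧
      epsB n i (μ n x) = epsS n i x := by
  refine ⟨bijOn_μ n, fun x hx i hi => ⟨μ_eS (by omega) hi hx, ?_, ?_⟩⟩
  all_goals
    have h0 : x 0 = 0 := hx 0 (Or.inl rfl)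
    have hn1 : x (n + 1) = 0 := hx (n + 1) (Or.inr n.lt_succ_self)
  · unfold wtB wtS
    simp only [μ_apply hx]
    grind
  · unfold epsB epsS
    simp only [μ_apply hx]
    grind

end Stmt12
end

section
/- For every n ≥ 3 the map μ : ℤ^{2n−1} → B given by b_1 = x̄_1, b_i = x̄_i − x̄_{i−1} (2 ≤ i ≤ n−1), b_n = x_n − x̄_{n−1}, b̄_i = x_{i−1} − x_i (2 ≤ i ≤ n), b̄_1 = −x_1, is a bijection onto B = {(b_1,…,b_n,b̄_n,…,b̄_1) ∈ ℤ^{2n} : Σ_{i=1}^n (b_i + b̄_i) = 0}, and for every x ∈ ℤ^{2n−1} and every i ∈ {0,1,…,n}: μ(ẽ_i(x)) = ẽ_i(μ(x)), wt_i(μ(x)) = wt_i(x), and ε_i(μ(x)) = ε_i(x). (Thus UD(V(B_n^{(1)})) ≅ B_∞(A_{2n−1}^{(2)}).) -/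
namespace Stmt13

/-- Points: pairs of integer sequences `(x_1, …, x_n ; x̄_1, …, x̄_{n-1})`
(resp. `(b_1, …, b_n ; b̄_1, …, b̄_n)`). -/
abbrev Pt : Type := (ℕ → ℤ) × (ℕ → ℤ)

/-- Source: `UD(V(B_n^{(1)}))` is `ℤ^{2n-1}`, with coordinates
`x_1, …, x_n, x̄_{n-1}, …, x̄_1`. -/
def S (n : ℕ) : Set Pt :=
  {p | (∀ j, j = 0 ∨ n < j → p.1 j = 0) ∧ (∀ j, j = 0 ∨ n - 1 < j → p.2 j = 0)}

/-- Target: the limit of perfect crystals `B_∞(A_{2n-1}^{(2)})`, the set of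
`(b_1, …, b_n, b̄_n, …, b̄_1) ∈ ℤ^{2n}` with `Σ (b_i + b̄_i) = 0`. -/
def B (n : ℕ) : Set Pt :=
  {q | (∀ j, j = 0 ∨ n < j → q.1 j = 0 ∧ q.2 j = 0) ∧
    ∑ j ∈ Finset.Icc 1 n, (q.1 j + q.2 j) = 0}

/-- `b_1 = x̄_1`, `b_i = x̄_i − x̄_{i−1}` (`2 ≤ i ≤ n−1`), `b_n = x_n − x̄_{n−1}`,
`b̄_i = x_{i−1} − x_i` (`2 ≤ i ≤ n`), `b̄_1 = −x_1`. -/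
def μ (n : ℕ) (p : Pt) : Pt :=
  (fun j =>
    if j = 1 then p.2 1
    else if 2 ≤ j ∧ j ≤ n - 1 then p.2 j - p.2 (j - 1)
    else if j = n then p.1 n - p.2 (n - 1)
    else 0,
   fun j =>
    if j = 1 then - p.1 1
    else if 2 ≤ j ∧ j ≤ n then p.1 (j - 1) - p.1 j
    else 0)

/-- Source crystal operators `ẽ_i` on `UD(V(B_n^{(1)}))`. -/
def eS (n i : ℕ) (p : Pt) : Pt :=
  if i = 0 then
    if p.1 1 + p.2 1 ≥ p.1 2 + p.2 2 then
      (fun j => if 2 ≤ j ∧ j ≤ n then p.1 j - 1 else p.1 j,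
       fun j => if 1 ≤ j ∧ j ≤ n - 1 then p.2 j - 1 else p.2 j)
    else
      (fun j => if 1 ≤ j ∧ j ≤ n then p.1 j - 1 else p.1 j,
       fun j => if 2 ≤ j ∧ j ≤ n - 1 then p.2 j - 1 else p.2 j)
  else if i = n then
    (fun j => if j = n then p.1 n + 1 else p.1 j, p.2)
  else if i = n - 1 then
    if p.1 (n-1) + p.2 (n-1) ≥ 2 * p.1 n then
      (fun j => if j = n - 1 then p.1 (n-1) + 1 else p.1 j, p.2)
    else
      (p.1, fun j => if j = n - 1 then p.2 (n-1) + 1 else p.2 j)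
  else
    if p.1 i + p.2 i ≥ p.1 (i+1) + p.2 (i+1) then
      (fun j => if j = i then p.1 i + 1 else p.1 j, p.2)
    else
      (p.1, fun j => if j = i then p.2 i + 1 else p.2 j)

/-- Target crystal operators `ẽ_i` on `B_∞(A_{2n-1}^{(2)})`. -/
def eB (n i : ℕ) (q : Pt) : Pt :=
  if i = 0 then
    if q.1 2 > q.2 2 then
      (fun j => if j = 2 then q.1 2 - 1 else q.1 j,
       fun j => if j = 1 then q.2 1 + 1 else q.2 j)
    else
      (fun j => if j = 1 then q.1 1 - 1 else q.1 j,
       fun j => if j = 2 then q.2 2 + 1 else q.2 j)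
  else if i = n then
    (fun j => if j = n then q.1 n + 1 else q.1 j,
     fun j => if j = n then q.2 n - 1 else q.2 j)
  else
    if q.1 (i+1) > q.2 (i+1) then
      (fun j => if j = i then q.1 i + 1 else if j = i + 1 then q.1 (i+1) - 1 else q.1 j,
       q.2)
    else
      (q.1,
       fun j => if j = i then q.2 i - 1 else if j = i + 1 then q.2 (i+1) + 1 else q.2 j)

/-- Source weights. -/
def wtS (n i : ℕ) (p : Pt) : ℤ :=
  if i = 0 then -(p.1 2 + p.2 2)
  else if i = 1 then 2 * (p.1 1 + p.2 1) - (p.1 2 + p.2 2)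
  else if i = n then 2 * p.1 n - (p.1 (n-1) + p.2 (n-1))
  else if i = n - 1 then
    -(p.1 (n-2) + p.2 (n-2)) + 2 * (p.1 (n-1) + p.2 (n-1)) - 2 * p.1 n
  else -(p.1 (i-1) + p.2 (i-1)) + 2 * (p.1 i + p.2 i) - (p.1 (i+1) + p.2 (i+1))

/-- Target weights. -/
def wtB (n i : ℕ) (q : Pt) : ℤ :=
  if i = 0 then q.2 1 - q.1 1 + q.2 2 - q.1 2
  else if i = n then q.1 n - q.2 n
  else q.1 i - q.2 i + q.2 (i+1) - q.1 (i+1)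

/-- Source `ε`-functions. -/
def epsS (n i : ℕ) (p : Pt) : ℤ :=
  if i = 0 then p.2 1 + max (p.1 2 + p.2 2 - p.1 1 - p.2 1) 0
  else if i = 1 then max (p.1 2 + p.2 2 - p.1 1 - p.2 1) 0 - p.1 1
  else if i = n then p.1 (n-1) - p.1 n
  else if i = n - 1 then
    p.1 (n-2) - p.1 (n-1) + max (2 * p.1 n - p.1 (n-1) - p.2 (n-1)) 0
  else p.1 (i-1) - p.1 i + max (p.1 (i+1) + p.2 (i+1) - p.1 i - p.2 i) 0

/-- Target `ε`-functions. -/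
def epsB (n i : ℕ) (q : Pt) : ℤ :=
  if i = 0 then q.1 1 + max (q.1 2 - q.2 2) 0
  else if i = n then q.2 n
  else q.2 i + max (q.1 (i+1) - q.2 (i+1)) 0

/-- The inverse of `μ n`, given by partial sums. -/
def partialSums (n : ℕ) (q : Pt) : Pt :=
  (fun j => if j ≤ n then -∑ k ∈ Finset.Icc 1 j, q.2 k else 0,
   fun j => if j ≤ n - 1 then ∑ k ∈ Finset.Icc 1 j, q.1 k else 0)

lemma sum_μ_fst {n : ℕ} {p : Pt} (hp : p ∈ S n) {m : ℕ} (hm : m ≤ n - 1) :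
    ∑ k ∈ Finset.Icc 1 m, (μ n p).1 k = p.2 m := by
  induction m with
  | zero => simp [hp.2 0 (Or.inl rfl)]
  | succ m ih =>
    rw [Finset.sum_Icc_succ_top (by omega), ih (by omega)]
    have h0 := hp.2 0 (Or.inl rfl)
    simp only [μ]
    grind

lemma sum_μ_snd {n : ℕ} {p : Pt} (hp : p ∈ S n) {m : ℕ} (hm : m ≤ n) :
    ∑ k ∈ Finset.Icc 1 m, (μ n p).2 k = -p.1 m := by
  induction m with
  | zero => simp [hp.1 0 (Or.inl rfl)]
  | succ m ih =>
    rw [Finset.sum_Icc_succ_top (by omega), ih (by omega)]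
    have h0 := hp.1 0 (Or.inl rfl)
    simp only [μ]
    grind

lemma mapsTo_μ {n : ℕ} (hn : 3 ≤ n) : Set.MapsTo (μ n) (S n) (B n) := by
  intro p hp
  refine ⟨fun j hj => by simp only [μ]; grind, ?_⟩
  obtain ⟨m, rfl⟩ : ∃ m, n = m + 1 := ⟨n - 1, by omega⟩
  rw [Finset.sum_add_distrib, sum_μ_snd hp le_rfl,
    Finset.sum_Icc_succ_top (by omega), sum_μ_fst hp (by omega)]
  simp only [μ]
  grind

lemma mapsTo_partialSums (n : ℕ) : Set.MapsTo (partialSums n) (B n) (S n) := by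
  intro q _
  constructor
  · rintro j (rfl | hj)
    · simp [partialSums]
    · simp [partialSums, hj]
  · rintro j (rfl | hj)
    · simp [partialSums]
    · simp [partialSums, hj]

lemma partialSums_μ {n : ℕ} {p : Pt} (hp : p ∈ S n) : partialSums n (μ n p) = p := by
  refine Prod.ext (funext fun j => ?_) (funext fun j => ?_)
  · by_cases hj : j ≤ n
    · simp [partialSums, hj, sum_μ_snd hp hj]
    · simp [partialSums, hj, hp.1 j (Or.inr (not_le.1 hj))]
  · by_cases hj : j ≤ n - 1
    · simp only [partialSums, hj, if_true, sum_μ_fst hp hj]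
    · simp only [partialSums, hj, if_false, hp.2 j (Or.inr (not_le.1 hj))]

lemma sum_Icc_pred {j : ℕ} (hj : 1 ≤ j) (f : ℕ → ℤ) :
    ∑ k ∈ Finset.Icc 1 j, f k = ∑ k ∈ Finset.Icc 1 (j - 1), f k + f j := by
  obtain ⟨m, rfl⟩ : ∃ m, j = m + 1 := ⟨j - 1, by omega⟩
  rw [Finset.sum_Icc_succ_top hj, Nat.add_sub_cancel]

lemma μ_partialSums {n : ℕ} (hn : 3 ≤ n) {q : Pt} (hq : q ∈ B n) :
    μ n (partialSums n q) = q := by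
  have hsum := hq.2
  have h1 (f : ℕ → ℤ) : ∑ k ∈ Finset.Icc 1 1, f k = f 1 := by simp
  rw [Finset.sum_add_distrib] at hsum
  refine Prod.ext (funext fun j => ?_) (funext fun j => ?_)
  · have hj (h : 1 ≤ j) := sum_Icc_pred h q.1
    have h0 := hq.1 j
    simp only [μ, partialSums]
    grind
  · have hj (h : 1 ≤ j) := sum_Icc_pred h q.2
    have h0 := hq.1 j
    simp only [μ, partialSums]
    grind

lemma bijOn_μ {n : ℕ} (hn : 3 ≤ n) : Set.BijOn (μ n) (S n) (B n) :=
  Set.InvOn.bijOn ⟨fun _ hp => partialSums_μ hp, fun _ hq => μ_partialSums hn hq⟩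
    (mapsTo_μ hn) (mapsTo_partialSums n)

lemma μ_eS {n : ℕ} (hn : 3 ≤ n) (p : Pt) {i : ℕ} (hi : i ≤ n) :
    μ n (eS n i p) = eB n i (μ n p) := by
  unfold eS eB
  split_ifs <;> refine Prod.ext (funext fun j => ?_) (funext fun j => ?_) <;>
    simp only [μ] at * <;> grind

lemma wtB_μ {n : ℕ} (hn : 3 ≤ n) (p : Pt) {i : ℕ} (hi : i ≤ n) :
    wtB n i (μ n p) = wtS n i p := by
  simp only [μ, wtB, wtS]
  grind

lemma epsB_μ {n : ℕ} (hn : 3 ≤ n) (p : Pt) {i : ℕ} (hi : i ≤ n) :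
    epsB n i (μ n p) = epsS n i p := by
  simp only [μ, epsB, epsS]
  grind

/-- `μ` is a bijection of `ℤ^{2n-1}` onto `B_∞(A_{2n-1}^{(2)})` commuting with the
crystal operators and preserving `wt_i` and `ε_i`; hence
`UD(V(B_n^{(1)})) ≅ B_∞(A_{2n-1}^{(2)})`. -/
theorem stmt13 (n : ℕ) (hn : 3 ≤ n) :
    Set.BijOn (μ n) (S n) (B n) ∧
    ∀ p ∈ S n, ∀ i ≤ n,
      μ n (eS n i p) = eB n i (μ n p) ∧
      wtB n i (μ n p) = wtS n i p ∧
      epsB n i (μ n p) = epsS n i p := by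
  exact ⟨bijOn_μ hn, fun p _ i hi => ⟨μ_eS hn p hi, wtB_μ hn p hi, epsB_μ hn p hi⟩⟩

end Stmt13
end

section
/- For every n ≥ 2 the map μ : ℤ^{2n} → B given by b_1 = x̄_1, b_i = x̄_i − x̄_{i−1} (2 ≤ i ≤ n−1), b_n = x_n/2 − x̄_{n−1}, b̄_n = x_{n−1} − x_n/2, b̄_i = x_{i−1} − x_i (1 ≤ i ≤ n−1), is a bijection from ℤ^{2n} (coordinates x_0, x_1, …, x_n, x̄_{n−1}, …, x̄_1) onto B = {(b_1,…,b_n,b̄_n,…,b̄_1) ∈ ℤ^{n−1} × (½ℤ)² × ℤ^{n−1} : b_n + b̄_n ∈ ℤ}, and for every x ∈ ℤ^{2n} and every i ∈ {0,1,…,n}: μ(ẽ_i(x)) = ẽ_i(μ(x)), wt_i(μ(x)) = wt_i(x), and ε_i(μ(x)) = ε_i(x). (Thus UD(V(C_n^{(1)})) ≅ B_∞(D_{n+1}^{(2)}).) -/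
namespace Stmt14

/-- Source points: pairs of integer sequences `(x_0, x_1, …, x_n ; x̄_1, …, x̄_{n-1})`. -/
abbrev PtZ : Type := (ℕ → ℤ) × (ℕ → ℤ)

/-- Target points: pairs of rational sequences `(b_1, …, b_n ; b̄_1, …, b̄_n)`. -/
abbrev PtQ : Type := (ℕ → ℚ) × (ℕ → ℚ)

/-- A rational number lying in `ℤ`. -/
def IsIntQ (q : ℚ) : Prop := ∃ m : ℤ, q = (m : ℚ)

/-- Source: `UD(V(C_n^{(1)}))` is `ℤ^{2n}` with coordinates
`x_0, x_1, …, x_n, x̄_{n-1}, …, x̄_1`. -/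
def S (n : ℕ) : Set PtZ :=
  {p | (∀ j, n < j → p.1 j = 0) ∧ (∀ j, j = 0 ∨ n - 1 < j → p.2 j = 0)}

/-- Target: the limit of perfect crystals `B_∞(D_{n+1}^{(2)})`, the set of
`(b_1,…,b_n,b̄_n,…,b̄_1) ∈ ℤ^{n−1} × (½ℤ)² × ℤ^{n−1}` with `b_n + b̄_n ∈ ℤ`. -/
def B (n : ℕ) : Set PtQ :=
  {q | (∀ j, j = 0 ∨ n < j → q.1 j = 0 ∧ q.2 j = 0) ∧
    (∀ j, 1 ≤ j → j ≤ n - 1 → IsIntQ (q.1 j) ∧ IsIntQ (q.2 j)) ∧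
    IsIntQ (2 * q.1 n) ∧ IsIntQ (2 * q.2 n) ∧ IsIntQ (q.1 n + q.2 n)}

/-- `b_1 = x̄_1`, `b_i = x̄_i − x̄_{i−1}` (`2 ≤ i ≤ n−1`), `b_n = x_n/2 − x̄_{n−1}`,
`b̄_n = x_{n−1} − x_n/2`, `b̄_i = x_{i−1} − x_i` (`1 ≤ i ≤ n−1`). -/
def μ (n : ℕ) (p : PtZ) : PtQ :=
  (fun j =>
    if j = 1 then (p.2 1 : ℚ)
    else if 2 ≤ j ∧ j ≤ n - 1 then (p.2 j : ℚ) - (p.2 (j - 1) : ℚ)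
    else if j = n then (p.1 n : ℚ) / 2 - (p.2 (n - 1) : ℚ)
    else 0,
   fun j =>
    if 1 ≤ j ∧ j ≤ n - 1 then (p.1 (j - 1) : ℚ) - (p.1 j : ℚ)
    else if j = n then (p.1 (n - 1) : ℚ) - (p.1 n : ℚ) / 2
    else 0)

/-- Source crystal operators `ẽ_i` on `UD(V(C_n^{(1)}))`. -/
def eS (n i : ℕ) (p : PtZ) : PtZ :=
  if i = 0 then
    if p.1 0 ≥ p.1 1 + p.2 1 then
      (fun j => if j = 0 then p.1 0 + 1 else p.1 j, p.2)
    else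
      (fun j => if j = 0 then p.1 0 - 1
                else if 1 ≤ j ∧ j ≤ n - 1 then p.1 j - 1
                else if j = n then p.1 n - 2
                else p.1 j,
       fun j => if 1 ≤ j ∧ j ≤ n - 1 then p.2 j - 1 else p.2 j)
  else if i = n then
    (fun j => if j = n then p.1 n + 1 else p.1 j, p.2)
  else if i = n - 1 then
    if p.1 (n-1) + p.2 (n-1) ≥ p.1 n then
      (fun j => if j = n - 1 then p.1 (n-1) + 1 else p.1 j, p.2)
    else
      (p.1, fun j => if j = n - 1 then p.2 (n-1) + 1 else p.2 j)
  else
    if p.1 i + p.2 i ≥ p.1 (i+1) + p.2 (i+1) then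
      (fun j => if j = i then p.1 i + 1 else p.1 j, p.2)
    else
      (p.1, fun j => if j = i then p.2 i + 1 else p.2 j)

/-- Target crystal operators `ẽ_i` on `B_∞(D_{n+1}^{(2)})`. -/
def eB (n i : ℕ) (q : PtQ) : PtQ :=
  if i = 0 then
    if q.1 1 > q.2 1 then
      (fun j => if j = 1 then q.1 1 - 1 else q.1 j, q.2)
    else
      (q.1, fun j => if j = 1 then q.2 1 + 1 else q.2 j)
  else if i = n then
    (fun j => if j = n then q.1 n + 1/2 else q.1 j,
     fun j => if j = n then q.2 n - 1/2 else q.2 j)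
  else
    if q.1 (i+1) > q.2 (i+1) then
      (fun j => if j = i then q.1 i + 1 else if j = i + 1 then q.1 (i+1) - 1 else q.1 j,
       q.2)
    else
      (q.1,
       fun j => if j = i then q.2 i - 1 else if j = i + 1 then q.2 (i+1) + 1 else q.2 j)

/-- Source weights. -/
def wtS (n i : ℕ) (p : PtZ) : ℤ :=
  if i = 0 then 2 * p.1 0 - 2 * (p.1 1 + p.2 1)
  else if i = n then 2 * p.1 n - 2 * (p.1 (n-1) + p.2 (n-1))
  else if i = n - 1 then
    -(p.1 (n-2) + p.2 (n-2)) + 2 * (p.1 (n-1) + p.2 (n-1)) - p.1 n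
  else if i = 1 then 2 * (p.1 1 + p.2 1) - (p.1 0 + p.1 2 + p.2 2)
  else -(p.1 (i-1) + p.2 (i-1)) + 2 * (p.1 i + p.2 i) - (p.1 (i+1) + p.2 (i+1))

/-- Target weights. -/
def wtB (n i : ℕ) (q : PtQ) : ℚ :=
  if i = 0 then 2 * (q.2 1 - q.1 1)
  else if i = n then 2 * (q.1 n - q.2 n)
  else q.1 i - q.2 i + q.2 (i+1) - q.1 (i+1)

/-- Source `ε`-functions. -/
def epsS (n i : ℕ) (p : PtZ) : ℤ :=
  if i = 0 then - p.1 0 + 2 * max (p.1 1 + p.2 1 - p.1 0) 0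
  else if i = n then 2 * p.1 (n-1) - p.1 n
  else if i = n - 1 then
    p.1 (n-2) - p.1 (n-1) + max (p.1 n - p.1 (n-1) - p.2 (n-1)) 0
  else p.1 (i-1) - p.1 i + max (p.1 (i+1) + p.2 (i+1) - p.1 i - p.2 i) 0

/-- Target `ε`-functions, with `l(b) = Σ_{i=1}^n (b_i + b̄_i)`. -/
def epsB (n i : ℕ) (q : PtQ) : ℚ :=
  if i = 0 then -(∑ j ∈ Finset.Icc 1 n, (q.1 j + q.2 j)) + 2 * max (q.1 1 - q.2 1) 0
  else if i = n then 2 * q.2 n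
  else q.2 i + max (q.1 (i+1) - q.2 (i+1)) 0

theorem μ_fst_of_lt {n j : ℕ} {p : PtZ} (hp : p ∈ S n) (h1 : 1 ≤ j) (hj : j < n) :
    (μ n p).1 j = (p.2 j : ℚ) - p.2 (j - 1) := by
  have h0 : p.2 0 = 0 := hp.2 0 (Or.inl rfl)
  by_cases h : j = 1
  · subst h; simp [μ, h0]
  · have : 2 ≤ j ∧ j ≤ n - 1 := by omega
    simp [μ, h, this]

theorem μ_fst_last {n : ℕ} (hn : 2 ≤ n) (p : PtZ) :
    (μ n p).1 n = (p.1 n : ℚ) / 2 - p.2 (n - 1) := by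
  have h1 : n ≠ 1 := by omega
  have h2 : ¬ (2 ≤ n ∧ n ≤ n - 1) := by omega
  simp only [μ, if_neg h1, if_neg h2, if_true]

theorem μ_snd_of_lt {n j : ℕ} (p : PtZ) (h1 : 1 ≤ j) (hj : j < n) :
    (μ n p).2 j = (p.1 (j - 1) : ℚ) - p.1 j := by
  have h : 1 ≤ j ∧ j ≤ n - 1 := by omega
  simp only [μ, if_pos h]

theorem μ_snd_last {n : ℕ} (hn : 2 ≤ n) (p : PtZ) :
    (μ n p).2 n = (p.1 (n - 1) : ℚ) - (p.1 n : ℚ) / 2 := by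
  have h : ¬ (1 ≤ n ∧ n ≤ n - 1) := by omega
  simp only [μ, if_neg h, if_true]

theorem μ_eq_zero {n j : ℕ} (hn : 2 ≤ n) (p : PtZ) (hj : j = 0 ∨ n < j) :
    (μ n p).1 j = 0 ∧ (μ n p).2 j = 0 := by
  constructor
  · simp only [μ]
    rw [if_neg (by omega), if_neg (by omega), if_neg (by omega)]
  · simp only [μ]
    rw [if_neg (by omega), if_neg (by omega)]

/-- Partial sums of `l(μ(x))` telescope. -/
theorem sum_μ_of_lt {n m : ℕ} {p : PtZ} (hp : p ∈ S n) (hm : m < n) :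
    ∑ j ∈ Finset.Icc 1 m, ((μ n p).1 j + (μ n p).2 j) = (p.2 m : ℚ) + p.1 0 - p.1 m := by
  induction m with
  | zero => simp [hp.2 0 (Or.inl rfl)]
  | succ k ih =>
    rw [Finset.sum_Icc_succ_top (by omega), ih (by omega),
      μ_fst_of_lt hp (by omega) hm, μ_snd_of_lt p (by omega) hm, Nat.add_sub_cancel]
    ring

theorem sum_μ {n : ℕ} (hn : 2 ≤ n) {p : PtZ} (hp : p ∈ S n) :
    ∑ j ∈ Finset.Icc 1 n, ((μ n p).1 j + (μ n p).2 j) = (p.1 0 : ℚ) := by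
  obtain ⟨m, rfl⟩ : ∃ m, n = m + 1 := ⟨n - 1, by omega⟩
  rw [Finset.sum_Icc_succ_top (by omega), sum_μ_of_lt hp (by omega),
    μ_fst_last hn, μ_snd_last hn, Nat.add_sub_cancel]
  ring

theorem mapsTo_μ {n : ℕ} (hn : 2 ≤ n) : Set.MapsTo (μ n) (S n) (B n) := by
  intro p hp
  refine ⟨fun j hj => μ_eq_zero hn p hj, fun j h1 hj => ⟨?_, ?_⟩, ?_, ?_, ?_⟩
  · exact ⟨p.2 j - p.2 (j - 1), by rw [μ_fst_of_lt hp h1 (by omega)]; push_cast; ring⟩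
  · exact ⟨p.1 (j - 1) - p.1 j, by rw [μ_snd_of_lt p h1 (by omega)]; push_cast; ring⟩
  · exact ⟨p.1 n - 2 * p.2 (n - 1), by rw [μ_fst_last hn]; push_cast; ring⟩
  · exact ⟨2 * p.1 (n - 1) - p.1 n, by rw [μ_snd_last hn]; push_cast; ring⟩
  · exact ⟨p.1 (n - 1) - p.2 (n - 1), by
      rw [μ_fst_last hn, μ_snd_last hn]; push_cast; ring⟩

theorem injOn_μ {n : ℕ} (hn : 2 ≤ n) : Set.InjOn (μ n) (S n) := by
  intro p hp q hq h
  have h2 : ∀ j < n, p.2 j = q.2 j := by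
    intro j hj
    induction j with
    | zero => rw [hp.2 0 (Or.inl rfl), hq.2 0 (Or.inl rfl)]
    | succ k ih =>
      have e := congrArg (fun b => b.1 (k + 1)) h
      simp only [μ_fst_of_lt hp (show 1 ≤ k + 1 by omega) hj,
        μ_fst_of_lt hq (show 1 ≤ k + 1 by omega) hj,
        Nat.add_sub_cancel, ih (by omega)] at e
      exact_mod_cast sub_left_injective e
  have hlast : p.1 n = q.1 n := by
    have e := congrArg (fun b => b.1 n) h
    simp only [μ_fst_last hn, h2 (n - 1) (by omega)] at e
    have e' : (p.1 n : ℚ) = q.1 n := by linarith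
    exact_mod_cast e'
  have hpred : p.1 (n - 1) = q.1 (n - 1) := by
    have e := congrArg (fun b => b.2 n) h
    simp only [μ_snd_last hn, hlast] at e
    exact_mod_cast sub_left_injective e
  have h1 : ∀ k < n, p.1 (n - 1 - k) = q.1 (n - 1 - k) := by
    intro k hk
    induction k with
    | zero => exact hpred
    | succ k ih =>
      have e := congrArg (fun b => b.2 (n - 1 - k)) h
      simp only [μ_snd_of_lt _ (show 1 ≤ n - 1 - k by omega) (show n - 1 - k < n by omega),
        ih (by omega)] at e
      rw [show n - 1 - (k + 1) = n - 1 - k - 1 by omega]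
      exact_mod_cast sub_left_injective e
  refine Prod.ext (funext fun j => ?_) (funext fun j => ?_)
  · rcases lt_trichotomy j n with hj | rfl | hj
    · simpa [show n - 1 - (n - 1 - j) = j by omega] using h1 (n - 1 - j) (by omega)
    · exact hlast
    · rw [hp.1 j hj, hq.1 j hj]
  · by_cases hj : j < n
    · exact h2 j hj
    · rw [hp.2 j (by omega), hq.2 j (by omega)]

theorem surjOn_μ {n : ℕ} (hn : 2 ≤ n) : Set.SurjOn (μ n) (S n) (B n) := by
  rintro b ⟨hzero, hint, ⟨a, ha⟩, -, ⟨c, hc⟩⟩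
  have hf : ∀ j, ∃ m : ℤ, 1 ≤ j → j ≤ n - 1 → b.1 j = m := fun j => by
    by_cases h : 1 ≤ j ∧ j ≤ n - 1
    · exact (hint j h.1 h.2).1.imp fun m hm _ _ => hm
    · exact ⟨0, fun h1 hj => absurd ⟨h1, hj⟩ h⟩
  have hg : ∀ j, ∃ m : ℤ, 1 ≤ j → j ≤ n - 1 → b.2 j = m := fun j => by
    by_cases h : 1 ≤ j ∧ j ≤ n - 1
    · exact (hint j h.1 h.2).2.imp fun m hm _ _ => hm
    · exact ⟨0, fun h1 hj => absurd ⟨h1, hj⟩ h⟩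
  choose f hf using hf
  choose g hg using hg
  set s : ℕ → ℤ := fun j => ∑ k ∈ Finset.Icc 1 j, f k
  set p : PtZ :=
    (fun j => if j < n then c + s (n - 1) + ∑ k ∈ Finset.Ico (j + 1) n, g k
              else if j = n then a + 2 * s (n - 1) else 0,
     fun j => if j < n then s j else 0)
  have p1 : ∀ j < n, p.1 j = c + s (n - 1) + ∑ k ∈ Finset.Ico (j + 1) n, g k :=
    fun j hj => if_pos hj
  have p1n : p.1 n = a + 2 * s (n - 1) := by simp [p]
  have p2 : ∀ j < n, p.2 j = s j := fun j hj => if_pos hj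
  have hp : p ∈ S n := by
    refine ⟨fun j hj => ?_, fun j hj => ?_⟩
    · simp [p, show ¬ j < n by omega, show j ≠ n by omega]
    · rcases hj with rfl | hj
      · simp [p, s]
      · simp [p, show ¬ j < n by omega]
  refine ⟨p, hp, Prod.ext (funext fun j => ?_) (funext fun j => ?_)⟩
  · by_cases h0 : j = 0 ∨ n < j
    · rw [(μ_eq_zero hn p h0).1, (hzero j h0).1]
    by_cases hj : j < n
    · rw [μ_fst_of_lt hp (by omega) hj, p2 j hj, p2 (j - 1) (by omega),
        hf j (by omega) (by omega)]
      obtain ⟨k, rfl⟩ : ∃ k, j = k + 1 := ⟨j - 1, by omega⟩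
      have : s (k + 1) = s k + f (k + 1) := Finset.sum_Icc_succ_top (by omega) f
      rw [this, Nat.add_sub_cancel]
      push_cast
      ring
    · obtain rfl : j = n := by omega
      rw [μ_fst_last hn, p1n, p2 (j - 1) (by omega)]
      push_cast
      linarith
  · by_cases h0 : j = 0 ∨ n < j
    · rw [(μ_eq_zero hn p h0).2, (hzero j h0).2]
    by_cases hj : j < n
    · rw [μ_snd_of_lt p (by omega) hj, p1 j hj, p1 (j - 1) (by omega),
        hg j (by omega) (by omega), show j - 1 + 1 = j by omega,
        Finset.sum_eq_sum_Ico_succ_bot hj]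
      push_cast
      ring
    · obtain rfl : j = n := by omega
      rw [μ_snd_last hn, p1n, p1 (j - 1) (by omega), show j - 1 + 1 = j by omega,
        Finset.Ico_self, Finset.sum_empty]
      push_cast
      linarith

theorem bijOn_μ {n : ℕ} (hn : 2 ≤ n) : Set.BijOn (μ n) (S n) (B n) :=
  ⟨mapsTo_μ hn, injOn_μ hn, surjOn_μ hn⟩

theorem wtB_μ {n i : ℕ} (hn : 2 ≤ n) {p : PtZ} (hp : p ∈ S n) (hi : i ≤ n) :
    wtB n i (μ n p) = (wtS n i p : ℚ) := by
  have h0 : p.2 0 = 0 := hp.2 0 (Or.inl rfl)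
  unfold wtB wtS
  by_cases hi0 : i = 0
  · subst hi0
    simp [μ_fst_of_lt hp le_rfl (show 1 < n by omega), μ_snd_of_lt p le_rfl (show 1 < n by omega),
      h0]
    ring
  by_cases hin : i = n
  · subst hin
    simp only [if_neg hi0, if_true, μ_fst_last hn, μ_snd_last hn]
    push_cast
    ring
  rw [if_neg hi0, if_neg hin, if_neg hi0, if_neg hin, μ_fst_of_lt hp (by omega) (by omega),
    μ_snd_of_lt p (by omega) (by omega)]
  by_cases him : i = n - 1
  · obtain ⟨m, rfl⟩ : ∃ m, n = m + 2 := ⟨n - 2, by omega⟩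
    obtain rfl : i = m + 1 := by omega
    rw [μ_fst_last hn, μ_snd_last hn]
    simp
    ring
  rw [if_neg him, μ_fst_of_lt hp (by omega) (by omega), μ_snd_of_lt p (by omega) (by omega),
    Nat.add_sub_cancel]
  by_cases hi1 : i = 1
  · subst hi1
    simp [h0]
    ring
  rw [if_neg hi1]
  push_cast
  ring

theorem epsB_μ {n i : ℕ} (hn : 2 ≤ n) {p : PtZ} (hp : p ∈ S n) (hi : i ≤ n) :
    epsB n i (μ n p) = (epsS n i p : ℚ) := by
  have h0 : p.2 0 = 0 := hp.2 0 (Or.inl rfl)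
  unfold epsB epsS
  by_cases hi0 : i = 0
  · subst hi0
    rw [if_pos rfl, if_pos rfl, sum_μ hn hp, μ_fst_of_lt hp le_rfl (by omega),
      μ_snd_of_lt p le_rfl (by omega), Nat.sub_self, h0]
    push_cast
    ring_nf
  by_cases hin : i = n
  · subst hin
    rw [if_neg hi0, if_neg hi0, if_pos rfl, if_pos rfl, μ_snd_last hn]
    push_cast
    ring
  rw [if_neg hi0, if_neg hin, if_neg hi0, if_neg hin, μ_snd_of_lt p (by omega) (by omega)]
  by_cases him : i = n - 1
  · obtain ⟨m, rfl⟩ : ∃ m, n = m + 2 := ⟨n - 2, by omega⟩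
    obtain rfl : i = m + 1 := by omega
    rw [if_pos him, μ_fst_last hn, μ_snd_last hn]
    simp only [Nat.add_sub_cancel, show m + 2 - 1 = m + 1 from rfl]
    push_cast
    ring_nf
  rw [if_neg him, μ_fst_of_lt hp (by omega) (by omega), μ_snd_of_lt p (by omega) (by omega),
    Nat.add_sub_cancel]
  push_cast
  ring_nf

theorem μ_eS_zero {n : ℕ} (hn : 2 ≤ n) (p : PtZ) :
    μ n (eS n 0 p) = eB n 0 (μ n p) := by
  have hc : (μ n p).1 1 > (μ n p).2 1 ↔ ¬ p.1 0 ≥ p.1 1 + p.2 1 := by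
    rw [μ_snd_of_lt p le_rfl (by omega), show (μ n p).1 1 = (p.2 1 : ℚ) by simp [μ],
      gt_iff_lt, ge_iff_le, not_le, sub_lt_iff_lt_add]
    norm_cast
    rw [add_comm]
  by_cases h : p.1 0 ≥ p.1 1 + p.2 1
  · simp only [eS, eB, if_true, if_pos h, if_neg (fun h' => hc.1 h' h)]
    refine Prod.ext (funext fun j => ?_) (funext fun j => ?_) <;>
      (simp only [μ]; push_cast; grind)
  · simp only [eS, eB, if_true, if_neg h, if_pos (hc.2 h)]
    refine Prod.ext (funext fun j => ?_) (funext fun j => ?_) <;>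
      (simp only [μ]; push_cast; grind)

theorem μ_eS_last {n : ℕ} (hn : 2 ≤ n) (p : PtZ) :
    μ n (eS n n p) = eB n n (μ n p) := by
  simp only [eS, eB, if_neg (show n ≠ 0 by omega), if_true]
  refine Prod.ext (funext fun j => ?_) (funext fun j => ?_) <;>
      (simp only [μ]; push_cast; grind)

theorem μ_eS_of_lt {n i : ℕ} {p : PtZ} (hp : p ∈ S n) (h1 : 1 ≤ i) (hi : i < n) :
    μ n (eS n i p) = eB n i (μ n p) := by
  have hn : 2 ≤ n := by omega
  have hi0 : i ≠ 0 := by omega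
  have hin : i ≠ n := by omega
  have hs : eS n i p =
      if (μ n p).1 (i + 1) > (μ n p).2 (i + 1) then
        (p.1, fun j => if j = i then p.2 i + 1 else p.2 j)
      else (fun j => if j = i then p.1 i + 1 else p.1 j, p.2) := by
    by_cases him : i = n - 1
    · have hc : (μ n p).1 (i + 1) > (μ n p).2 (i + 1) ↔
          ¬ p.1 (n - 1) + p.2 (n - 1) ≥ p.1 n := by
        rw [show i + 1 = n by omega, μ_fst_last hn, μ_snd_last hn, ge_iff_le, not_le,
          ← Int.cast_lt (R := ℚ), Int.cast_add]
        constructor <;> intro h <;> linarith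
      simp only [eS, hc, if_neg hi0, if_neg hin, if_true, ite_not, ← him]
    · have hc : (μ n p).1 (i + 1) > (μ n p).2 (i + 1) ↔
          ¬ p.1 i + p.2 i ≥ p.1 (i + 1) + p.2 (i + 1) := by
        rw [μ_fst_of_lt hp (by omega) (by omega), μ_snd_of_lt p (by omega) (by omega),
          Nat.add_sub_cancel, ge_iff_le, not_le, ← Int.cast_lt (R := ℚ), Int.cast_add,
          Int.cast_add]
        constructor <;> intro h <;> linarith
      simp only [eS, hc, if_neg hi0, if_neg hin, if_neg him, ite_not]
  rw [hs]
  by_cases h : (μ n p).1 (i + 1) > (μ n p).2 (i + 1)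
  · simp only [eB, if_neg hi0, if_neg hin, if_pos h]
    refine Prod.ext (funext fun j => ?_) rfl
    simp only [μ]
    push_cast
    grind
  · simp only [eB, if_neg hi0, if_neg hin, if_neg h]
    refine Prod.ext (funext fun j => ?_) (funext fun j => ?_) <;>
      (simp only [μ]; push_cast; grind)

/-- `μ` is a bijection of `ℤ^{2n}` onto `B_∞(D_{n+1}^{(2)})` commuting with the
crystal operators and preserving `wt_i` and `ε_i`; hence
`UD(V(C_n^{(1)})) ≅ B_∞(D_{n+1}^{(2)})`. -/
theorem stmt14 (n : ℕ) (hn : 2 ≤ n) :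
    Set.BijOn (μ n) (S n) (B n) ∧
    ∀ p ∈ S n, ∀ i ≤ n,
      μ n (eS n i p) = eB n i (μ n p) ∧
      wtB n i (μ n p) = (wtS n i p : ℚ) ∧
      epsB n i (μ n p) = (epsS n i p : ℚ) := by
  refine ⟨bijOn_μ hn, fun p hp i hi => ⟨?_, wtB_μ hn hp hi, epsB_μ hn hp hi⟩⟩
  rcases Nat.eq_zero_or_pos i with rfl | h1
  · exact μ_eS_zero hn p
  rcases hi.eq_or_lt with rfl | hlt
  · exact μ_eS_last hn p
  · exact μ_eS_of_lt hp h1 hlt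

end Stmt14
end

section
/- For every n ≥ 4 the map μ : ℤ^{2n−2} → B given by b_1 = x̄_1, b_i = x̄_i − x̄_{i−1} (2 ≤ i ≤ n−2), b_{n−1} = x_{n−1} − x̄_{n−2}, b_n = x_n − x_{n−1}, b̄_{n−1} = x_{n−2} − x_n, b̄_i = x_{i−1} − x_i (2 ≤ i ≤ n−2), b̄_1 = −x_1, is a bijection from ℤ^{2n−2} (coordinates x_1, …, x_n, x̄_{n−2}, …, x̄_1) onto B = {(b_1,…,b_n,b̄_{n−1},…,b̄_1) ∈ ℤ^{2n−1} : Σ_{i=1}^n b_i + Σ_{i=1}^{n−1} b̄_i = 0}, and for every x ∈ ℤ^{2n−2} and every i ∈ {0,1,…,n}: μ(ẽ_i(x)) = ẽ_i(μ(x)), wt_i(μ(x)) = wt_i(x), and ε_i(μ(x)) = ε_i(x). (Thus UD(V(D_n^{(1)})) ≅ B_∞(D_n^{(1)}).) -/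
namespace Stmt15

/-- Points: pairs of integer sequences. -/
abbrev Pt : Type := (ℕ → ℤ) × (ℕ → ℤ)

/-- Source: `UD(V(D_n^{(1)}))` is `ℤ^{2n-2}`, with coordinates
`x_1, …, x_n, x̄_{n-2}, …, x̄_1`. -/
def S (n : ℕ) : Set Pt :=
  {p | (∀ j, j = 0 ∨ n < j → p.1 j = 0) ∧ (∀ j, j = 0 ∨ n - 2 < j → p.2 j = 0)}

/-- Target: the limit of perfect crystals `B_∞(D_n^{(1)})`, the set of
`(b_1, …, b_n, b̄_{n-1}, …, b̄_1) ∈ ℤ^{2n-1}` with `Σ b_i + Σ b̄_i = 0`. -/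
def B (n : ℕ) : Set Pt :=
  {q | (∀ j, j = 0 ∨ n < j → q.1 j = 0) ∧ (∀ j, j = 0 ∨ n - 1 < j → q.2 j = 0) ∧
    (∑ j ∈ Finset.Icc 1 n, q.1 j) + (∑ j ∈ Finset.Icc 1 (n - 1), q.2 j) = 0}

/-- `b_1 = x̄_1`, `b_i = x̄_i − x̄_{i−1}` (`2 ≤ i ≤ n−2`), `b_{n−1} = x_{n−1} − x̄_{n−2}`,
`b_n = x_n − x_{n−1}`, `b̄_{n−1} = x_{n−2} − x_n`, `b̄_i = x_{i−1} − x_i`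
(`2 ≤ i ≤ n−2`), `b̄_1 = −x_1`. -/
def μ (n : ℕ) (p : Pt) : Pt :=
  (fun j =>
    if j = 1 then p.2 1
    else if 2 ≤ j ∧ j ≤ n - 2 then p.2 j - p.2 (j - 1)
    else if j = n - 1 then p.1 (n-1) - p.2 (n-2)
    else if j = n then p.1 n - p.1 (n-1)
    else 0,
   fun j =>
    if j = 1 then - p.1 1
    else if 2 ≤ j ∧ j ≤ n - 2 then p.1 (j - 1) - p.1 j
    else if j = n - 1 then p.1 (n-2) - p.1 n
    else 0)

/-- Source crystal operators `ẽ_i` on `UD(V(D_n^{(1)}))`. -/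
def eS (n i : ℕ) (p : Pt) : Pt :=
  if i = 0 then
    if p.1 1 + p.2 1 ≥ p.1 2 + p.2 2 then
      (fun j => if 2 ≤ j ∧ j ≤ n then p.1 j - 1 else p.1 j,
       fun j => if 1 ≤ j ∧ j ≤ n - 2 then p.2 j - 1 else p.2 j)
    else
      (fun j => if 1 ≤ j ∧ j ≤ n then p.1 j - 1 else p.1 j,
       fun j => if 2 ≤ j ∧ j ≤ n - 2 then p.2 j - 1 else p.2 j)
  else if i = n then
    (fun j => if j = n then p.1 n + 1 else p.1 j, p.2)
  else if i = n - 1 then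
    (fun j => if j = n - 1 then p.1 (n-1) + 1 else p.1 j, p.2)
  else if i = n - 2 then
    if p.1 (n-2) + p.2 (n-2) ≥ p.1 (n-1) + p.1 n then
      (fun j => if j = n - 2 then p.1 (n-2) + 1 else p.1 j, p.2)
    else
      (p.1, fun j => if j = n - 2 then p.2 (n-2) + 1 else p.2 j)
  else
    if p.1 i + p.2 i ≥ p.1 (i+1) + p.2 (i+1) then
      (fun j => if j = i then p.1 i + 1 else p.1 j, p.2)
    else
      (p.1, fun j => if j = i then p.2 i + 1 else p.2 j)

/-- Target crystal operators `ẽ_i` on `B_∞(D_n^{(1)})`. -/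
def eB (n i : ℕ) (q : Pt) : Pt :=
  if i = 0 then
    if q.1 2 > q.2 2 then
      (fun j => if j = 2 then q.1 2 - 1 else q.1 j,
       fun j => if j = 1 then q.2 1 + 1 else q.2 j)
    else
      (fun j => if j = 1 then q.1 1 - 1 else q.1 j,
       fun j => if j = 2 then q.2 2 + 1 else q.2 j)
  else if i = n then
    (fun j => if j = n then q.1 n + 1 else q.1 j,
     fun j => if j = n - 1 then q.2 (n-1) - 1 else q.2 j)
  else if i = n - 1 then
    (fun j => if j = n - 1 then q.1 (n-1) + 1 else if j = n then q.1 n - 1 else q.1 j,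
     q.2)
  else
    if q.1 (i+1) > q.2 (i+1) then
      (fun j => if j = i then q.1 i + 1 else if j = i + 1 then q.1 (i+1) - 1 else q.1 j,
       q.2)
    else
      (q.1,
       fun j => if j = i then q.2 i - 1 else if j = i + 1 then q.2 (i+1) + 1 else q.2 j)

/-- Source weights. -/
def wtS (n i : ℕ) (p : Pt) : ℤ :=
  if i = 0 then -(p.1 2 + p.2 2)
  else if i = 1 then 2 * (p.1 1 + p.2 1) - (p.1 2 + p.2 2)
  else if i = n then 2 * p.1 n - (p.1 (n-2) + p.2 (n-2))
  else if i = n - 1 then 2 * p.1 (n-1) - (p.1 (n-2) + p.2 (n-2))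
  else if i = n - 2 then
    -(p.1 (n-3) + p.2 (n-3)) + 2 * (p.1 (n-2) + p.2 (n-2)) - (p.1 (n-1) + p.1 n)
  else -(p.1 (i-1) + p.2 (i-1)) + 2 * (p.1 i + p.2 i) - (p.1 (i+1) + p.2 (i+1))

/-- Target weights. -/
def wtB (n i : ℕ) (q : Pt) : ℤ :=
  if i = 0 then q.2 1 - q.1 1 + q.2 2 - q.1 2
  else if i = n then q.1 (n-1) - q.2 (n-1) + q.1 n
  else if i = n - 1 then q.1 (n-1) - q.2 (n-1) - q.1 n
  else q.1 i - q.2 i + q.2 (i+1) - q.1 (i+1)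

/-- Source `ε`-functions. -/
def epsS (n i : ℕ) (p : Pt) : ℤ :=
  if i = 0 then p.2 1 + max (p.1 2 + p.2 2 - p.1 1 - p.2 1) 0
  else if i = 1 then max (p.1 2 + p.2 2 - p.1 1 - p.2 1) 0 - p.1 1
  else if i = n then p.1 (n-2) - p.1 n
  else if i = n - 1 then p.1 (n-2) - p.1 (n-1)
  else if i = n - 2 then
    p.1 (n-3) - p.1 (n-2) + max (p.1 (n-1) + p.1 n - p.1 (n-2) - p.2 (n-2)) 0
  else p.1 (i-1) - p.1 i + max (p.1 (i+1) + p.2 (i+1) - p.1 i - p.2 i) 0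

/-- Target `ε`-functions. -/
def epsB (n i : ℕ) (q : Pt) : ℤ :=
  if i = 0 then q.1 1 + max (q.1 2 - q.2 2) 0
  else if i = n then q.2 (n-1)
  else if i = n - 1 then q.1 n + q.2 (n-1)
  else q.2 i + max (q.1 (i+1) - q.2 (i+1)) 0

lemma sum_μ_fst {n : ℕ} {p : Pt} (hp : p ∈ S n) {k : ℕ} (hk : k ≤ n - 2) :
    ∑ j ∈ Finset.Icc 1 k, (μ n p).1 j = p.2 k := by
  induction k with
  | zero => simp [hp.2 0 (Or.inl rfl)]
  | succ k ih =>
    rw [Finset.sum_Icc_succ_top (by omega), ih (by omega)]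
    have := hp.2 0 (Or.inl rfl)
    simp only [μ]
    grind

lemma sum_μ_snd {n : ℕ} {p : Pt} (hp : p ∈ S n) {k : ℕ} (hk : k ≤ n - 2) :
    ∑ j ∈ Finset.Icc 1 k, (μ n p).2 j = -p.1 k := by
  induction k with
  | zero => simp [hp.1 0 (Or.inl rfl)]
  | succ k ih =>
    rw [Finset.sum_Icc_succ_top (by omega), ih (by omega)]
    have := hp.1 0 (Or.inl rfl)
    simp only [μ]
    grind

lemma sum_μ_fst_pred {n : ℕ} (hn : 4 ≤ n) {p : Pt} (hp : p ∈ S n) :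
    ∑ j ∈ Finset.Icc 1 (n - 1), (μ n p).1 j = p.1 (n - 1) := by
  rw [show n - 1 = n - 2 + 1 by omega, Finset.sum_Icc_succ_top (by omega), sum_μ_fst hp le_rfl]
  simp only [μ]
  grind

lemma sum_μ_fst_self {n : ℕ} (hn : 4 ≤ n) {p : Pt} (hp : p ∈ S n) :
    ∑ j ∈ Finset.Icc 1 n, (μ n p).1 j = p.1 n := by
  obtain ⟨m, rfl⟩ : ∃ m, n = m + 1 := ⟨n - 1, by omega⟩
  have h := sum_μ_fst_pred hn hp
  rw [Nat.add_sub_cancel] at h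
  rw [Finset.sum_Icc_succ_top (by omega), h]
  simp only [μ]
  grind

lemma sum_μ_snd_pred {n : ℕ} (hn : 4 ≤ n) {p : Pt} (hp : p ∈ S n) :
    ∑ j ∈ Finset.Icc 1 (n - 1), (μ n p).2 j = -p.1 n := by
  rw [show n - 1 = n - 2 + 1 by omega, Finset.sum_Icc_succ_top (by omega), sum_μ_snd hp le_rfl]
  simp only [μ]
  grind

lemma mapsTo_μ {n : ℕ} (hn : 4 ≤ n) : Set.MapsTo (μ n) (S n) (B n) := by
  intro p hp
  refine ⟨fun j hj => ?_, fun j hj => ?_, ?_⟩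
  · simp only [μ]
    grind
  · simp only [μ]
    grind
  · rw [sum_μ_fst_self hn hp, sum_μ_snd_pred hn hp, add_neg_cancel]

lemma injOn_μ {n : ℕ} (hn : 4 ≤ n) : Set.InjOn (μ n) (S n) := by
  intro p hp q hq h
  refine Prod.ext (funext fun j => ?_) (funext fun j => ?_)
  · rcases le_or_gt j (n - 2) with hj | hj
    · rw [← neg_inj, ← sum_μ_snd hp hj, ← sum_μ_snd hq hj, h]
    · obtain rfl | rfl | hj : j = n - 1 ∨ j = n ∨ n < j := by omega
      · rw [← sum_μ_fst_pred hn hp, ← sum_μ_fst_pred hn hq, h]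
      · rw [← sum_μ_fst_self hn hp, ← sum_μ_fst_self hn hq, h]
      · rw [hp.1 j (Or.inr hj), hq.1 j (Or.inr hj)]
  · rcases le_or_gt j (n - 2) with hj | hj
    · rw [← sum_μ_fst hp hj, ← sum_μ_fst hq hj, h]
    · rw [hp.2 j (Or.inr hj), hq.2 j (Or.inr hj)]

/-- The inverse of `μ n`, given by partial sums. -/
def μInv (n : ℕ) (q : Pt) : Pt :=
  (fun j =>
    if j ≤ n - 2 then -∑ k ∈ Finset.Icc 1 j, q.2 k
    else if j ≤ n then ∑ k ∈ Finset.Icc 1 j, q.1 k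
    else 0,
   fun j => if j ≤ n - 2 then ∑ k ∈ Finset.Icc 1 j, q.1 k else 0)

lemma μInv_mem {n : ℕ} (hn : 4 ≤ n) (q : Pt) : μInv n q ∈ S n := by
  refine ⟨fun j hj => ?_, fun j hj => ?_⟩
  · rcases hj with rfl | hj
    · simp [μInv]
    · simp only [μInv]
      grind
  · rcases hj with rfl | hj
    · simp [μInv]
    · simp only [μInv]
      grind

lemma sum_Icc_eq_add (f : ℕ → ℤ) {j : ℕ} (hj : 1 ≤ j) :
    ∑ k ∈ Finset.Icc 1 j, f k = ∑ k ∈ Finset.Icc 1 (j - 1), f k + f j := by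
  obtain ⟨m, rfl⟩ : ∃ m, j = m + 1 := ⟨j - 1, by omega⟩
  rw [Finset.sum_Icc_succ_top (by omega), Nat.add_sub_cancel]

lemma μ_μInv {n : ℕ} (hn : 4 ≤ n) {q : Pt} (hq : q ∈ B n) : μ n (μInv n q) = q := by
  obtain ⟨h₁, h₂, h₃⟩ := hq
  have hs₁ := fun j => sum_Icc_eq_add q.1 (j := j)
  have hs₂ := fun j => sum_Icc_eq_add q.2 (j := j)
  have hz₁ : ∑ k ∈ Finset.Icc 1 0, q.1 k = 0 := by simp
  have hz₂ : ∑ k ∈ Finset.Icc 1 0, q.2 k = 0 := by simp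
  refine Prod.ext (funext fun j => ?_) (funext fun j => ?_)
  · have := h₁ j
    have := hs₁ j
    have := hs₁ n
    simp only [μ, μInv]
    clear hs₁ hs₂ h₁ h₂
    grind
  · have := h₂ j
    have := hs₂ j
    have := hs₂ (n - 1)
    simp only [μ, μInv]
    clear hs₁ hs₂ h₁ h₂
    grind

lemma bijOn_μ {n : ℕ} (hn : 4 ≤ n) : Set.BijOn (μ n) (S n) (B n) :=
  ⟨mapsTo_μ hn, injOn_μ hn, fun q hq => ⟨μInv n q, μInv_mem hn q, μ_μInv hn hq⟩⟩

lemma μ_eS {n : ℕ} (hn : 4 ≤ n) (p : Pt) {i : ℕ} (hi : i ≤ n) :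
    μ n (eS n i p) = eB n i (μ n p) := by
  by_cases h₀ : i = 0
  · by_cases h : p.1 1 + p.2 1 ≥ p.1 2 + p.2 2
    all_goals
      refine Prod.ext (funext fun j => ?_) (funext fun j => ?_) <;>
      · simp only [μ, eS, eB, if_pos h₀, h, ↓reduceIte]
        grind
  by_cases h₁ : i = n
  · refine Prod.ext (funext fun j => ?_) (funext fun j => ?_) <;>
    · simp only [μ, eS, eB, if_neg h₀, if_pos h₁]
      grind
  by_cases h₂ : i = n - 1
  · refine Prod.ext (funext fun j => ?_) (funext fun j => ?_) <;>
    · simp only [μ, eS, eB, if_neg h₀, if_neg h₁, if_pos h₂]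
      grind
  by_cases h₃ : i = n - 2
  · by_cases h : p.1 (n - 2) + p.2 (n - 2) ≥ p.1 (n - 1) + p.1 n
    all_goals
      refine Prod.ext (funext fun j => ?_) (funext fun j => ?_) <;>
      · simp only [μ, eS, eB, if_neg h₀, if_neg h₁, if_neg h₂, if_pos h₃, h, ↓reduceIte]
        grind
  · by_cases h : p.1 i + p.2 i ≥ p.1 (i + 1) + p.2 (i + 1)
    all_goals
      refine Prod.ext (funext fun j => ?_) (funext fun j => ?_) <;>
      · simp only [μ, eS, eB, if_neg h₀, if_neg h₁, if_neg h₂, if_neg h₃, h, ↓reduceIte]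
        grind

lemma wtB_μ {n : ℕ} (hn : 4 ≤ n) (p : Pt) {i : ℕ} (hi : i ≤ n) :
    wtB n i (μ n p) = wtS n i p := by
  simp only [μ, wtB, wtS]
  grind

lemma epsB_μ {n : ℕ} (hn : 4 ≤ n) (p : Pt) {i : ℕ} (hi : i ≤ n) :
    epsB n i (μ n p) = epsS n i p := by
  simp only [μ, epsB, epsS]
  grind

/-- `μ` is a bijection of `ℤ^{2n-2}` onto `B_∞(D_n^{(1)})` commuting with the crystal
operators and preserving `wt_i` and `ε_i`; hence `UD(V(D_n^{(1)})) ≅ B_∞(D_n^{(1)})`. -/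
theorem stmt15 (n : ℕ) (hn : 4 ≤ n) :
    Set.BijOn (μ n) (S n) (B n) ∧
    ∀ p ∈ S n, ∀ i ≤ n,
      μ n (eS n i p) = eB n i (μ n p) ∧
      wtB n i (μ n p) = wtS n i p ∧
      epsB n i (μ n p) = epsS n i p := by
  exact ⟨bijOn_μ hn, fun p _ i hi => ⟨μ_eS hn p hi, wtB_μ hn p hi, epsB_μ hn p hi⟩⟩

end Stmt15
end

section
/- For every n ≥ 3 the map μ : ℤ^{2n−1} → B given by b_1 = x̄_1, b_i = x̄_i − x̄_{i−1} (2 ≤ i ≤ n−1), b_n = x_n/2 − x̄_{n−1}, b̄_n = x_{n−1} − x_n/2, b̄_i = x_{i−1} − x_i (2 ≤ i ≤ n−1), b̄_1 = −x_1, is a bijection from ℤ^{2n−1} (coordinates x_1, …, x_n, x̄_{n−1}, …, x̄_1) onto B = {(b_1,…,b_n,b̄_n,…,b̄_1) ∈ ℤ^{n−1} × (½ℤ)² × ℤ^{n−1} : Σ_{i=1}^n (b_i+b̄_i) = 0, b_n+b̄_n ∈ ℤ}, and for every x ∈ ℤ^{2n−1} and every i ∈ {0,1,…,n}: μ(ẽ_i(x))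 = ẽ_i(μ(x)), wt_i(μ(x)) = wt_i(x), and ε_i(μ(x)) = ε_i(x). (Thus UD(V(A_{2n−1}^{(2)})) ≅ B_∞(B_n^{(1)}).) -/
namespace Stmt16

/-- Source points: pairs of integer sequences `(x_1, …, x_n ; x̄_1, …, x̄_{n-1})`. -/
abbrev PtZ : Type := (ℕ → ℤ) × (ℕ → ℤ)

/-- Target points: pairs of rational sequences `(b_1, …, b_n ; b̄_1, …, b̄_n)`. -/
abbrev PtQ : Type := (ℕ → ℚ) × (ℕ → ℚ)

/-- A rational number lying in `ℤ`. -/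
def IsIntQ (q : ℚ) : Prop := ∃ m : ℤ, q = (m : ℚ)

/-- Source: `UD(V(A_{2n-1}^{(2)}))` is `ℤ^{2n-1}`, with coordinates
`x_1, …, x_n, x̄_{n-1}, …, x̄_1`. -/
def S (n : ℕ) : Set PtZ :=
  {p | (∀ j, j = 0 ∨ n < j → p.1 j = 0) ∧ (∀ j, j = 0 ∨ n - 1 < j → p.2 j = 0)}

/-- Target: the limit of perfect crystals `B_∞(B_n^{(1)})`, the set of
`(b_1,…,b_n,b̄_n,…,b̄_1) ∈ ℤ^{n−1} × (½ℤ)² × ℤ^{n−1}` with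
`Σ (b_i + b̄_i) = 0` and `b_n + b̄_n ∈ ℤ`. -/
def B (n : ℕ) : Set PtQ :=
  {q | (∀ j, j = 0 ∨ n < j → q.1 j = 0 ∧ q.2 j = 0) ∧
    (∀ j, 1 ≤ j → j ≤ n - 1 → IsIntQ (q.1 j) ∧ IsIntQ (q.2 j)) ∧
    IsIntQ (2 * q.1 n) ∧ IsIntQ (2 * q.2 n) ∧ IsIntQ (q.1 n + q.2 n) ∧
    ∑ j ∈ Finset.Icc 1 n, (q.1 j + q.2 j) = 0}

/-- `b_1 = x̄_1`, `b_i = x̄_i − x̄_{i−1}` (`2 ≤ i ≤ n−1`), `b_n = x_n/2 − x̄_{n−1}`,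
`b̄_n = x_{n−1} − x_n/2`, `b̄_i = x_{i−1} − x_i` (`2 ≤ i ≤ n−1`), `b̄_1 = −x_1`. -/
def μ (n : ℕ) (p : PtZ) : PtQ :=
  (fun j =>
    if j = 1 then (p.2 1 : ℚ)
    else if 2 ≤ j ∧ j ≤ n - 1 then (p.2 j : ℚ) - (p.2 (j - 1) : ℚ)
    else if j = n then (p.1 n : ℚ) / 2 - (p.2 (n - 1) : ℚ)
    else 0,
   fun j =>
    if j = 1 then - (p.1 1 : ℚ)
    else if 2 ≤ j ∧ j ≤ n - 1 then (p.1 (j - 1) : ℚ) - (p.1 j : ℚ)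
    else if j = n then (p.1 (n - 1) : ℚ) - (p.1 n : ℚ) / 2
    else 0)

/-- Source crystal operators `ẽ_i` on `UD(V(A_{2n-1}^{(2)}))`. -/
def eS (n i : ℕ) (p : PtZ) : PtZ :=
  if i = 0 then
    if p.1 1 + p.2 1 ≥ p.1 2 + p.2 2 then
      (fun j => if 2 ≤ j ∧ j ≤ n - 1 then p.1 j - 1
                else if j = n then p.1 n - 2 else p.1 j,
       fun j => if 1 ≤ j ∧ j ≤ n - 1 then p.2 j - 1 else p.2 j)
    else
      (fun j => if 1 ≤ j ∧ j ≤ n - 1 then p.1 j - 1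
                else if j = n then p.1 n - 2 else p.1 j,
       fun j => if 2 ≤ j ∧ j ≤ n - 1 then p.2 j - 1 else p.2 j)
  else if i = n then
    (fun j => if j = n then p.1 n + 1 else p.1 j, p.2)
  else if i = n - 1 then
    if p.1 (n-1) + p.2 (n-1) ≥ p.1 n then
      (fun j => if j = n - 1 then p.1 (n-1) + 1 else p.1 j, p.2)
    else
      (p.1, fun j => if j = n - 1 then p.2 (n-1) + 1 else p.2 j)
  else
    if p.1 i + p.2 i ≥ p.1 (i+1) + p.2 (i+1) then
      (fun j => if j = i then p.1 i + 1 else p.1 j, p.2)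
    else
      (p.1, fun j => if j = i then p.2 i + 1 else p.2 j)

/-- Target crystal operators `ẽ_i` on `B_∞(B_n^{(1)})`. -/
def eB (n i : ℕ) (q : PtQ) : PtQ :=
  if i = 0 then
    if q.1 2 > q.2 2 then
      (fun j => if j = 2 then q.1 2 - 1 else q.1 j,
       fun j => if j = 1 then q.2 1 + 1 else q.2 j)
    else
      (fun j => if j = 1 then q.1 1 - 1 else q.1 j,
       fun j => if j = 2 then q.2 2 + 1 else q.2 j)
  else if i = n then
    (fun j => if j = n then q.1 n + 1/2 else q.1 j,
     fun j => if j = n then q.2 n - 1/2 else q.2 j)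
  else
    if q.1 (i+1) > q.2 (i+1) then
      (fun j => if j = i then q.1 i + 1 else if j = i + 1 then q.1 (i+1) - 1 else q.1 j,
       q.2)
    else
      (q.1,
       fun j => if j = i then q.2 i - 1 else if j = i + 1 then q.2 (i+1) + 1 else q.2 j)

/-- Source weights. -/
def wtS (n i : ℕ) (p : PtZ) : ℤ :=
  if i = 0 then -(p.1 2 + p.2 2)
  else if i = 1 then 2 * (p.1 1 + p.2 1) - (p.1 2 + p.2 2)
  else if i = n then 2 * p.1 n - 2 * (p.1 (n-1) + p.2 (n-1))
  else if i = n - 1 then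
    -(p.1 (n-2) + p.2 (n-2)) + 2 * (p.1 (n-1) + p.2 (n-1)) - p.1 n
  else -(p.1 (i-1) + p.2 (i-1)) + 2 * (p.1 i + p.2 i) - (p.1 (i+1) + p.2 (i+1))

/-- Target weights. -/
def wtB (n i : ℕ) (q : PtQ) : ℚ :=
  if i = 0 then q.2 1 - q.1 1 + q.2 2 - q.1 2
  else if i = n then 2 * (q.1 n - q.2 n)
  else q.1 i - q.2 i + q.2 (i+1) - q.1 (i+1)

/-- Source `ε`-functions. -/
def epsS (n i : ℕ) (p : PtZ) : ℤ :=
  if i = 0 then p.2 1 + max (p.1 2 + p.2 2 - p.1 1 - p.2 1) 0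
  else if i = 1 then max (p.1 2 + p.2 2 - p.1 1 - p.2 1) 0 - p.1 1
  else if i = n then 2 * p.1 (n-1) - p.1 n
  else if i = n - 1 then
    p.1 (n-2) - p.1 (n-1) + max (p.1 n - p.1 (n-1) - p.2 (n-1)) 0
  else p.1 (i-1) - p.1 i + max (p.1 (i+1) + p.2 (i+1) - p.1 i - p.2 i) 0

/-- Target `ε`-functions. -/
def epsB (n i : ℕ) (q : PtQ) : ℚ :=
  if i = 0 then q.1 1 + max (q.1 2 - q.2 2) 0
  else if i = n then 2 * q.2 n
  else q.2 i + max (q.1 (i+1) - q.2 (i+1)) 0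

section Coordinates

variable {n : ℕ} (p : PtZ)

lemma μ_fst_one : (μ n p).1 1 = p.2 1 := by simp [μ]

lemma μ_snd_one : (μ n p).2 1 = -p.1 1 := by simp [μ]

lemma μ_fst_mid {j : ℕ} (h2 : 2 ≤ j) (hj : j ≤ n - 1) :
    (μ n p).1 j = p.2 j - p.2 (j - 1) := by
  have : j ≠ 1 := by omega
  simp [μ, *]

lemma μ_snd_mid {j : ℕ} (h2 : 2 ≤ j) (hj : j ≤ n - 1) :
    (μ n p).2 j = p.1 (j - 1) - p.1 j := by
  have : j ≠ 1 := by omega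
  simp [μ, *]

lemma μ_fst_last (hn : 3 ≤ n) : (μ n p).1 n = p.1 n / 2 - p.2 (n - 1) := by
  have h1 : n ≠ 1 := by omega
  have h2 : ¬ n ≤ n - 1 := by omega
  simp [μ, h1, h2]

lemma μ_snd_last (hn : 3 ≤ n) : (μ n p).2 n = p.1 (n - 1) - p.1 n / 2 := by
  have h1 : n ≠ 1 := by omega
  have h2 : ¬ n ≤ n - 1 := by omega
  simp [μ, h1, h2]

lemma μ_fst_out (hn : 3 ≤ n) {j : ℕ} (hj : j = 0 ∨ n < j) : (μ n p).1 j = 0 := by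
  have h1 : j ≠ 1 := by omega
  have h2 : ¬ (2 ≤ j ∧ j ≤ n - 1) := by omega
  have h3 : j ≠ n := by omega
  simp [μ, h1, h2, h3]

lemma μ_snd_out (hn : 3 ≤ n) {j : ℕ} (hj : j = 0 ∨ n < j) : (μ n p).2 j = 0 := by
  have h1 : j ≠ 1 := by omega
  have h2 : ¬ (2 ≤ j ∧ j ≤ n - 1) := by omega
  have h3 : j ≠ n := by omega
  simp [μ, h1, h2, h3]

end Coordinates

lemma isIntQ_intCast (m : ℤ) : IsIntQ m := ⟨m, rfl⟩

lemma IsIntQ.neg {a : ℚ} : IsIntQ a → IsIntQ (-a) := by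
  rintro ⟨m, rfl⟩
  exact ⟨-m, by push_cast; rfl⟩

lemma IsIntQ.add {a b : ℚ} : IsIntQ a → IsIntQ b → IsIntQ (a + b) := by
  rintro ⟨m, rfl⟩ ⟨k, rfl⟩
  exact ⟨m + k, by push_cast; rfl⟩

lemma IsIntQ.sum {s : Finset ℕ} {f : ℕ → ℚ} (h : ∀ k ∈ s, IsIntQ (f k)) :
    IsIntQ (∑ k ∈ s, f k) :=
  Finset.sum_induction f IsIntQ (fun _ _ => IsIntQ.add) ⟨0, by simp⟩ h

lemma IsIntQ.floor_eq {a : ℚ} : IsIntQ a → (⌊a⌋ : ℚ) = a := by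
  rintro ⟨m, rfl⟩
  simp

/-- The sum over the first `m < n` pairs of coordinates of `μ n p` telescopes. -/
lemma sum_μ (n : ℕ) (p : PtZ) (m : ℕ) (h1 : 1 ≤ m) (hm : m ≤ n - 1) :
    ∑ j ∈ Finset.Icc 1 m, ((μ n p).1 j + (μ n p).2 j) = p.2 m - p.1 m := by
  induction m, h1 using Nat.le_induction with
  | base => simp [μ_fst_one, μ_snd_one]; ring
  | succ k hk ih =>
    rw [Finset.sum_Icc_succ_top (by omega), ih (by omega), μ_fst_mid p (by omega) hm,
      μ_snd_mid p (by omega) hm]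
    simp only [Nat.add_sub_cancel]
    ring

lemma mapsTo_μ {n : ℕ} (hn : 3 ≤ n) : Set.MapsTo (μ n) (S n) (B n) := by
  intro p _
  refine ⟨fun j hj => ⟨μ_fst_out p hn hj, μ_snd_out p hn hj⟩, fun j h1 hj => ?_, ?_, ?_, ?_, ?_⟩
  · rcases h1.eq_or_lt with rfl | h2
    · rw [μ_fst_one, μ_snd_one]
      exact ⟨isIntQ_intCast _, (isIntQ_intCast _).neg⟩
    · rw [μ_fst_mid p h2 hj, μ_snd_mid p h2 hj]
      exact ⟨⟨p.2 j - p.2 (j - 1), by push_cast; rfl⟩, ⟨p.1 (j - 1) - p.1 j, by push_cast; rfl⟩⟩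
  · rw [μ_fst_last p hn]
    exact ⟨p.1 n - 2 * p.2 (n - 1), by push_cast; ring⟩
  · rw [μ_snd_last p hn]
    exact ⟨2 * p.1 (n - 1) - p.1 n, by push_cast; ring⟩
  · rw [μ_fst_last p hn, μ_snd_last p hn]
    exact ⟨p.1 (n - 1) - p.2 (n - 1), by push_cast; ring⟩
  · obtain ⟨m, rfl⟩ : ∃ m, n = m + 1 := ⟨n - 1, by omega⟩
    rw [Finset.sum_Icc_succ_top (by omega), sum_μ (m + 1) p m (by omega) (by omega),
      μ_fst_last p hn, μ_snd_last p hn]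
    simp only [Nat.add_sub_cancel]
    ring

lemma injOn_μ {n : ℕ} (hn : 3 ≤ n) : Set.InjOn (μ n) (S n) := by
  intro p hp q hq h
  have h_fst : ∀ j, (μ n p).1 j = (μ n q).1 j := fun j => by rw [h]
  have h_snd : ∀ j, (μ n p).2 j = (μ n q).2 j := fun j => by rw [h]
  have key : ∀ m, 1 ≤ m → m ≤ n - 1 → p.1 m = q.1 m ∧ p.2 m = q.2 m := by
    intro m h1
    induction m, h1 using Nat.le_induction with
    | base =>
      intro _
      have e1 := h_fst 1
      have e2 := h_snd 1
      rw [μ_fst_one, μ_fst_one] at e1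
      rw [μ_snd_one, μ_snd_one] at e2
      exact ⟨by exact_mod_cast neg_injective e2, by exact_mod_cast e1⟩
    | succ k hk ih =>
      intro hm
      obtain ⟨i1, i2⟩ := ih (by omega)
      have e1 := h_fst (k + 1)
      have e2 := h_snd (k + 1)
      rw [μ_fst_mid _ (by omega) hm, μ_fst_mid _ (by omega) hm, Nat.add_sub_cancel, i2] at e1
      rw [μ_snd_mid _ (by omega) hm, μ_snd_mid _ (by omega) hm, Nat.add_sub_cancel, i1] at e2
      exact ⟨by exact_mod_cast sub_right_injective e2, by exact_mod_cast sub_left_injective e1⟩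
  have h_last : p.1 n = q.1 n := by
    have e := h_fst n
    rw [μ_fst_last p hn, μ_fst_last q hn, (key (n - 1) (by omega) le_rfl).2] at e
    have : (p.1 n : ℚ) = q.1 n := by linarith
    exact_mod_cast this
  refine Prod.ext (funext fun j => ?_) (funext fun j => ?_)
  · by_cases hj : j = 0 ∨ n < j
    · rw [hp.1 j hj, hq.1 j hj]
    · rcases eq_or_ne j n with rfl | hjn
      · exact h_last
      · exact (key j (by omega) (by omega)).1
  · by_cases hj : j = 0 ∨ n - 1 < j
    · rw [hp.2 j hj, hq.2 j hj]
    · exact (key j (by omega) (by omega)).2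

lemma surjOn_μ {n : ℕ} (hn : 3 ≤ n) : Set.SurjOn (μ n) (S n) (B n) := by
  rintro q ⟨h_out, h_int, h_int_fst, -, -, h_sum⟩
  let a : ℕ → ℚ := fun m => ∑ k ∈ Finset.Icc 1 m, q.1 k
  let c : ℕ → ℚ := fun m => ∑ k ∈ Finset.Icc 1 m, q.2 k
  have a_int : ∀ m ≤ n - 1, (⌊a m⌋ : ℚ) = a m := fun m hm =>
    (IsIntQ.sum fun k hk => by
      rw [Finset.mem_Icc] at hk
      exact (h_int k hk.1 (by omega)).1).floor_eq
  have c_int : ∀ m ≤ n - 1, (⌊c m⌋ : ℚ) = c m := fun m hm =>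
    (IsIntQ.sum fun k hk => by
      rw [Finset.mem_Icc] at hk
      exact (h_int k hk.1 (by omega)).2).floor_eq
  have a_succ : ∀ m, 1 ≤ m → a m = a (m - 1) + q.1 m := fun m hm => by
    obtain ⟨k, rfl⟩ : ∃ k, m = k + 1 := ⟨m - 1, by omega⟩
    exact Finset.sum_Icc_succ_top (by omega) _
  have c_succ : ∀ m, 1 ≤ m → c m = c (m - 1) + q.2 m := fun m hm => by
    obtain ⟨k, rfl⟩ : ∃ k, m = k + 1 := ⟨m - 1, by omega⟩
    exact Finset.sum_Icc_succ_top (by omega) _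
  have ac : a n + c n = 0 := by rw [← h_sum, Finset.sum_add_distrib]
  have two_a_int : (⌊2 * a n⌋ : ℚ) = 2 * a n := by
    obtain ⟨k, hk⟩ := h_int_fst
    refine IsIntQ.floor_eq ⟨2 * ⌊a (n - 1)⌋ + k, ?_⟩
    push_cast
    rw [a_int _ le_rfl, ← hk, a_succ n (by omega)]
    ring
  let p : PtZ :=
    (fun j => if j = n then ⌊2 * a n⌋ else if j ≤ n - 1 then -⌊c j⌋ else 0,
      fun j => if j ≤ n - 1 then ⌊a j⌋ else 0)
  have p_fst : ∀ j ≤ n - 1, (p.1 j : ℚ) = -c j := fun j hj => by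
    have : j ≠ n := by omega
    simp [p, this, hj, c_int j hj]
  have p_snd : ∀ j ≤ n - 1, (p.2 j : ℚ) = a j := fun j hj => by
    simp [p, hj, a_int j hj]
  have p_last : (p.1 n : ℚ) = 2 * a n := by simp [p, two_a_int]
  refine ⟨p, ⟨fun j hj => ?_, fun j hj => ?_⟩, ?_⟩
  · rcases hj with rfl | hj
    · have : 0 ≠ n := by omega
      simp [p, this, c]
    · have h1 : j ≠ n := by omega
      have h2 : ¬ j ≤ n - 1 := by omega
      simp [p, h1, h2]
  · rcases hj with rfl | hj
    · simp [p, a]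
    · simp [p, not_le.mpr hj]
  · refine Prod.ext (funext fun j => ?_) (funext fun j => ?_)
    · by_cases h0 : j = 0 ∨ n < j
      · rw [μ_fst_out p hn h0, (h_out j h0).1]
      · rcases eq_or_ne j n with rfl | hjn
        · rw [μ_fst_last p hn, p_last, p_snd _ le_rfl, a_succ j (by omega)]
          ring
        · rcases eq_or_ne j 1 with rfl | hj1
          · rw [μ_fst_one, p_snd 1 (by omega)]
            simp [a]
          · rw [μ_fst_mid p (by omega) (by omega), p_snd j (by omega), p_snd (j - 1) (by omega),
              a_succ j (by omega)]
            ring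
    · by_cases h0 : j = 0 ∨ n < j
      · rw [μ_snd_out p hn h0, (h_out j h0).2]
      · rcases eq_or_ne j n with rfl | hjn
        · rw [μ_snd_last p hn, p_last, p_fst _ le_rfl]
          linarith [c_succ j (by omega)]
        · rcases eq_or_ne j 1 with rfl | hj1
          · rw [μ_snd_one, p_fst 1 (by omega)]
            simp [c]
          · rw [μ_snd_mid p (by omega) (by omega), p_fst j (by omega), p_fst (j - 1) (by omega),
              c_succ j (by omega)]
            ring

/-- The case distinction of `eB` at an inner coordinate, read off from the source. -/
lemma μ_mid_lt_iff {n : ℕ} (p : PtZ) {j : ℕ} (h2 : 2 ≤ j) (hj : j ≤ n - 1) :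
    (μ n p).1 j > (μ n p).2 j ↔ ¬ p.1 (j - 1) + p.2 (j - 1) ≥ p.1 j + p.2 j := by
  rw [μ_fst_mid p h2 hj, μ_snd_mid p h2 hj, not_le, ← Int.cast_lt (R := ℚ)]
  push_cast
  constructor <;> intro h <;> linarith

lemma μ_last_lt_iff {n : ℕ} (hn : 3 ≤ n) (p : PtZ) :
    (μ n p).1 n > (μ n p).2 n ↔ ¬ p.1 (n - 1) + p.2 (n - 1) ≥ p.1 n := by
  rw [μ_fst_last p hn, μ_snd_last p hn, not_le, ← Int.cast_lt (R := ℚ)]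
  push_cast
  constructor <;> intro h <;> linarith

/-- `μ n p = q` as soon as `q` has the coordinates prescribed by the definition of `μ`. -/
lemma μ_eq_of_coords {n : ℕ} (hn : 3 ≤ n) {p : PtZ} {q : PtQ}
    (h_out : ∀ j, j = 0 ∨ n < j → q.1 j = 0 ∧ q.2 j = 0)
    (h_one : q.1 1 = p.2 1 ∧ q.2 1 = -p.1 1)
    (h_mid : ∀ j, 2 ≤ j → j ≤ n - 1 →
      q.1 j = p.2 j - p.2 (j - 1) ∧ q.2 j = p.1 (j - 1) - p.1 j)
    (h_last : q.1 n = p.1 n / 2 - p.2 (n - 1) ∧ q.2 n = p.1 (n - 1) - p.1 n / 2) :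
    μ n p = q := by
  have key : ∀ j, (μ n p).1 j = q.1 j ∧ (μ n p).2 j = q.2 j := by
    intro j
    by_cases h0 : j = 0 ∨ n < j
    · rw [μ_fst_out p hn h0, μ_snd_out p hn h0, (h_out j h0).1, (h_out j h0).2]
      exact ⟨rfl, rfl⟩
    · rcases eq_or_ne j n with rfl | hjn
      · rw [μ_fst_last p hn, μ_snd_last p hn, h_last.1, h_last.2]
        exact ⟨rfl, rfl⟩
      · rcases eq_or_ne j 1 with rfl | hj1
        · rw [μ_fst_one, μ_snd_one, h_one.1, h_one.2]
          exact ⟨rfl, rfl⟩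
        · have h := h_mid j (by omega) (by omega)
          rw [μ_fst_mid p (by omega) (by omega), μ_snd_mid p (by omega) (by omega), h.1, h.2]
          exact ⟨rfl, rfl⟩
  exact Prod.ext (funext fun j => (key j).1) (funext fun j => (key j).2)

lemma μ_eS_zero {n : ℕ} (hn : 3 ≤ n) (p : PtZ) : μ n (eS n 0 p) = eB n 0 (μ n p) := by
  have h2n : 2 ≤ n - 1 := by omega
  have a1 := μ_fst_one (n := n) p
  have a2 := μ_snd_one (n := n) p
  have l1 := μ_fst_last p hn
  have l2 := μ_snd_last p hn
  have c := μ_mid_lt_iff p le_rfl h2n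
  simp only [eB, eS, c, if_true, ite_not]
  split_ifs with h
  all_goals
    apply μ_eq_of_coords hn
    · intro j hj
      have o1 := μ_fst_out p hn hj
      have o2 := μ_snd_out p hn hj
      clear a1 a2 l1 l2 c h
      grind
    · clear l1 l2 c h
      push_cast
      grind
    · intro j h2 hj
      have m1 := μ_fst_mid p h2 hj
      have m2 := μ_snd_mid p h2 hj
      clear a1 a2 l1 l2 c h
      push_cast
      grind
    · clear a1 a2 c h
      push_cast
      grind

lemma μ_eS_last {n : ℕ} (hn : 3 ≤ n) (p : PtZ) : μ n (eS n n p) = eB n n (μ n p) := by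
  have a1 := μ_fst_one (n := n) p
  have a2 := μ_snd_one (n := n) p
  have l1 := μ_fst_last p hn
  have l2 := μ_snd_last p hn
  have hn0 : n ≠ 0 := by omega
  simp only [eB, eS, hn0, if_true, if_false]
  apply μ_eq_of_coords hn
  · intro j hj
    have o1 := μ_fst_out p hn hj
    have o2 := μ_snd_out p hn hj
    grind
  · grind
  · intro j h2 hj
    have m1 := μ_fst_mid p h2 hj
    have m2 := μ_snd_mid p h2 hj
    grind
  · grind

lemma μ_eS_penultimate {n : ℕ} (hn : 3 ≤ n) (p : PtZ) :
    μ n (eS n (n - 1) p) = eB n (n - 1) (μ n p) := by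
  have a1 := μ_fst_one (n := n) p
  have a2 := μ_snd_one (n := n) p
  have l1 := μ_fst_last p hn
  have l2 := μ_snd_last p hn
  have h0 : n - 1 ≠ 0 := by omega
  have h1 : n - 1 ≠ n := by omega
  have hs : n - 1 + 1 = n := by omega
  simp only [eB, eS, h0, h1, hs, μ_last_lt_iff hn, if_true, if_false, ite_not]
  split_ifs with h
  all_goals
    clear h
    apply μ_eq_of_coords hn
    · intro j hj
      have o1 := μ_fst_out p hn hj
      have o2 := μ_snd_out p hn hj
      clear a1 a2 l1 l2
      grind
    · grind
    · intro j h2 hj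
      have m1 := μ_fst_mid p h2 hj
      have m2 := μ_snd_mid p h2 hj
      clear a1 a2 l1 l2
      push_cast
      grind
    · grind

lemma μ_eS_inner {n : ℕ} (hn : 3 ≤ n) (p : PtZ) {i : ℕ} (hi0 : i ≠ 0) (hi : i + 1 ≤ n - 1) :
    μ n (eS n i p) = eB n i (μ n p) := by
  have a1 := μ_fst_one (n := n) p
  have a2 := μ_snd_one (n := n) p
  have l1 := μ_fst_last p hn
  have l2 := μ_snd_last p hn
  have h1 : i ≠ n := by omega
  have h2 : i ≠ n - 1 := by omega
  have c := μ_mid_lt_iff p (by omega) hi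
  simp only [Nat.add_sub_cancel] at c
  simp only [eB, eS, hi0, h1, h2, c, if_false, ite_not]
  clear c
  split_ifs with h
  all_goals
    clear h
    apply μ_eq_of_coords hn
    · intro j hj
      have o1 := μ_fst_out p hn hj
      have o2 := μ_snd_out p hn hj
      clear a1 a2 l1 l2
      grind
    · push_cast
      grind
    · intro j h2 hj
      have m1 := μ_fst_mid p h2 hj
      have m2 := μ_snd_mid p h2 hj
      clear a1 a2 l1 l2
      push_cast
      grind
    · grind

lemma index_cases {n i : ℕ} (hi : i ≤ n) :
    i = 0 ∨ i = n ∨ i = n - 1 ∨ (i ≠ 0 ∧ i + 1 ≤ n - 1) := by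
  omega

lemma μ_eS {n : ℕ} (hn : 3 ≤ n) (p : PtZ) {i : ℕ} (hi : i ≤ n) :
    μ n (eS n i p) = eB n i (μ n p) := by
  rcases index_cases hi with rfl | rfl | rfl | ⟨h0, h1⟩
  · exact μ_eS_zero hn p
  · exact μ_eS_last hn p
  · exact μ_eS_penultimate hn p
  · exact μ_eS_inner hn p h0 h1

lemma wtB_μ {n : ℕ} (hn : 3 ≤ n) (p : PtZ) {i : ℕ} (hi : i ≤ n) :
    wtB n i (μ n p) = wtS n i p := by
  have two_le : 2 ≤ n - 1 := by omega
  have h1 : n ≠ 0 := by omega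
  have h2 : n ≠ 1 := by omega
  have h3 : n - 1 ≠ 0 := by omega
  have h4 : n - 1 ≠ 1 := by omega
  have h5 : n - 1 ≠ n := by omega
  have h6 : n - 1 + 1 = n := by omega
  have h7 : n - 1 - 1 = n - 2 := by omega
  rcases index_cases hi with rfl | rfl | rfl | ⟨h0, hi1⟩
  · simp only [wtB, wtS, if_true, μ_fst_one, μ_snd_one, μ_fst_mid p le_rfl two_le,
      μ_snd_mid p le_rfl two_le]
    push_cast
    ring
  · simp only [wtB, wtS, h1, h2, if_true, if_false, μ_fst_last p hn, μ_snd_last p hn]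
    push_cast
    ring
  · simp only [wtB, wtS, h3, h4, h5, h6, h7, if_true, if_false, μ_fst_last p hn, μ_snd_last p hn,
      μ_fst_mid p two_le le_rfl, μ_snd_mid p two_le le_rfl]
    push_cast
    ring
  · have hin : i ≠ n := by omega
    have hin1 : i ≠ n - 1 := by omega
    rcases eq_or_ne i 1 with rfl | hi2
    · simp only [wtB, wtS, one_ne_zero, hin, if_true, if_false, μ_fst_one, μ_snd_one,
        Nat.reduceAdd, μ_fst_mid p le_rfl two_le, μ_snd_mid p le_rfl two_le]
      push_cast
      ring
    · have hi3 : 2 ≤ i := by omega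
      have hi4 : i ≤ n - 1 := by omega
      have hi5 : 2 ≤ i + 1 := by omega
      simp only [wtB, wtS, h0, hi2, hin, hin1, if_false, μ_fst_mid p hi3 hi4,
        μ_snd_mid p hi3 hi4, μ_fst_mid p hi5 hi1,
        μ_snd_mid p hi5 hi1, Nat.add_sub_cancel]
      push_cast
      ring

lemma epsB_μ {n : ℕ} (hn : 3 ≤ n) (p : PtZ) {i : ℕ} (hi : i ≤ n) :
    epsB n i (μ n p) = epsS n i p := by
  have two_le : 2 ≤ n - 1 := by omega
  have h1 : n ≠ 0 := by omega
  have h2 : n ≠ 1 := by omega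
  have h3 : n - 1 ≠ 0 := by omega
  have h4 : n - 1 ≠ 1 := by omega
  have h5 : n - 1 ≠ n := by omega
  have h6 : n - 1 + 1 = n := by omega
  have h7 : n - 1 - 1 = n - 2 := by omega
  rcases index_cases hi with rfl | rfl | rfl | ⟨h0, hi1⟩
  · simp only [epsB, epsS, if_true, μ_fst_one, μ_fst_mid p le_rfl two_le,
      μ_snd_mid p le_rfl two_le]
    push_cast
    ring_nf
  · simp only [epsB, epsS, h1, h2, if_true, if_false, μ_snd_last p hn]
    push_cast
    ring
  · simp only [epsB, epsS, h3, h4, h5, h6, h7, if_true, if_false, μ_fst_last p hn, μ_snd_last p hn,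
      μ_snd_mid p two_le le_rfl]
    push_cast
    ring_nf
  · have hin : i ≠ n := by omega
    have hin1 : i ≠ n - 1 := by omega
    rcases eq_or_ne i 1 with rfl | hi2
    · simp only [epsB, epsS, one_ne_zero, hin, if_true, if_false, μ_snd_one,
        Nat.reduceAdd, μ_fst_mid p le_rfl two_le, μ_snd_mid p le_rfl two_le]
      push_cast
      ring_nf
    · have hi3 : 2 ≤ i := by omega
      have hi4 : i ≤ n - 1 := by omega
      have hi5 : 2 ≤ i + 1 := by omega
      simp only [epsB, epsS, h0, hi2, hin, hin1, if_false,
        μ_snd_mid p hi3 hi4, μ_fst_mid p hi5 hi1,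
        μ_snd_mid p hi5 hi1, Nat.add_sub_cancel]
      push_cast
      ring_nf

/-- `μ` is a bijection of `ℤ^{2n-1}` onto `B_∞(B_n^{(1)})` commuting with the crystal
operators and preserving `wt_i` and `ε_i`; hence
`UD(V(A_{2n-1}^{(2)})) ≅ B_∞(B_n^{(1)})`. -/
theorem stmt16 (n : ℕ) (hn : 3 ≤ n) :
    Set.BijOn (μ n) (S n) (B n) ∧
    ∀ p ∈ S n, ∀ i ≤ n,
      μ n (eS n i p) = eB n i (μ n p) ∧
      wtB n i (μ n p) = (wtS n i p : ℚ) ∧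
      epsB n i (μ n p) = (epsS n i p : ℚ) := by
  refine ⟨⟨mapsTo_μ hn, injOn_μ hn, surjOn_μ hn⟩, fun p _ i hi => ?_⟩
  exact ⟨μ_eS hn p hi, wtB_μ hn p hi, epsB_μ hn p hi⟩

end Stmt16
end

section
/- For every n ≥ 2 the map μ : ℤ^{2n} → ℤ^{2n} given by b_1 = x̄_1, b_i = x̄_i − x̄_{i−1} (2 ≤ i ≤ n−1), b_n = x_n − x̄_{n−1}, b̄_i = x_{i−1} − x_i (1 ≤ i ≤ n), where the source has coordinates (x_0, x_1, …, x_n, x̄_{n−1}, …, x̄_1) and the target has coordinates (b_1,…,b_n,b̄_n,…,b̄_1), is a bijection, and for every x ∈ ℤ^{2n} and every i ∈ {0,1,…,n}: μ(ẽ_i(x)) = ẽ_i(μ(x)), wt_i(μ(x)) = wt_i(x), and ε_i(μ(x)) = ε_i(x). (Thus UD(V(A_{2n}^{(2)†})) ≅ B_∞(A_{2n}^{(2)}).) -/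
namespace Stmt18

/-- Points: pairs of integer sequences. -/
abbrev Pt : Type := (ℕ → ℤ) × (ℕ → ℤ)

/-- Source: `UD(V(A_{2n}^{(2)†}))` is `ℤ^{2n}`, with coordinates
`x_0, x_1, …, x_n, x̄_{n-1}, …, x̄_1`. -/
def S (n : ℕ) : Set Pt :=
  {p | (∀ j, n < j → p.1 j = 0) ∧ (∀ j, j = 0 ∨ n - 1 < j → p.2 j = 0)}

/-- Target: the limit of perfect crystals `B_∞(A_{2n}^{(2)})`, all of `ℤ^{2n}`
(coordinates `b_1, …, b_n, b̄_n, …, b̄_1`). -/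
def B (n : ℕ) : Set Pt :=
  {q | ∀ j, j = 0 ∨ n < j → q.1 j = 0 ∧ q.2 j = 0}

/-- `b_1 = x̄_1`, `b_i = x̄_i − x̄_{i−1}` (`2 ≤ i ≤ n−1`), `b_n = x_n − x̄_{n−1}`,
`b̄_i = x_{i−1} − x_i` (`1 ≤ i ≤ n`). -/
def μ (n : ℕ) (p : Pt) : Pt :=
  (fun j =>
    if j = 1 then p.2 1
    else if 2 ≤ j ∧ j ≤ n - 1 then p.2 j - p.2 (j - 1)
    else if j = n then p.1 n - p.2 (n - 1)
    else 0,
   fun j =>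
    if 1 ≤ j ∧ j ≤ n then p.1 (j - 1) - p.1 j
    else 0)

/-- Source crystal operators `ẽ_i` on `UD(V(A_{2n}^{(2)†}))`. -/
def eS (n i : ℕ) (p : Pt) : Pt :=
  if i = 0 then
    if p.1 0 ≥ p.1 1 + p.2 1 then
      (fun j => if j = 0 then p.1 0 + 1 else p.1 j, p.2)
    else
      (fun j => if j ≤ n then p.1 j - 1 else p.1 j,
       fun j => if 1 ≤ j ∧ j ≤ n - 1 then p.2 j - 1 else p.2 j)
  else if i = n then
    (fun j => if j = n then p.1 n + 1 else p.1 j, p.2)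
  else if i = n - 1 then
    if p.1 (n-1) + p.2 (n-1) ≥ 2 * p.1 n then
      (fun j => if j = n - 1 then p.1 (n-1) + 1 else p.1 j, p.2)
    else
      (p.1, fun j => if j = n - 1 then p.2 (n-1) + 1 else p.2 j)
  else
    if p.1 i + p.2 i ≥ p.1 (i+1) + p.2 (i+1) then
      (fun j => if j = i then p.1 i + 1 else p.1 j, p.2)
    else
      (p.1, fun j => if j = i then p.2 i + 1 else p.2 j)

/-- Target crystal operators `ẽ_i` on `B_∞(A_{2n}^{(2)})`. -/
def eB (n i : ℕ) (q : Pt) : Pt :=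
  if i = 0 then
    if q.1 1 > q.2 1 then
      (fun j => if j = 1 then q.1 1 - 1 else q.1 j, q.2)
    else
      (q.1, fun j => if j = 1 then q.2 1 + 1 else q.2 j)
  else if i = n then
    (fun j => if j = n then q.1 n + 1 else q.1 j,
     fun j => if j = n then q.2 n - 1 else q.2 j)
  else
    if q.1 (i+1) > q.2 (i+1) then
      (fun j => if j = i then q.1 i + 1 else if j = i + 1 then q.1 (i+1) - 1 else q.1 j,
       q.2)
    else
      (q.1,
       fun j => if j = i then q.2 i - 1 else if j = i + 1 then q.2 (i+1) + 1 else q.2 j)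

/-- Source weights. -/
def wtS (n i : ℕ) (p : Pt) : ℤ :=
  if i = 0 then 2 * p.1 0 - 2 * (p.1 1 + p.2 1)
  else if i = n then 2 * p.1 n - (p.1 (n-1) + p.2 (n-1))
  else if i = n - 1 then
    -(p.1 (n-2) + p.2 (n-2)) + 2 * (p.1 (n-1) + p.2 (n-1)) - 2 * p.1 n
  else if i = 1 then 2 * (p.1 1 + p.2 1) - (p.1 0 + p.1 2 + p.2 2)
  else -(p.1 (i-1) + p.2 (i-1)) + 2 * (p.1 i + p.2 i) - (p.1 (i+1) + p.2 (i+1))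

/-- Target weights. -/
def wtB (n i : ℕ) (q : Pt) : ℤ :=
  if i = 0 then 2 * (q.2 1 - q.1 1)
  else if i = n then q.1 n - q.2 n
  else q.1 i - q.2 i + q.2 (i+1) - q.1 (i+1)

/-- Source `ε`-functions. -/
def epsS (n i : ℕ) (p : Pt) : ℤ :=
  if i = 0 then - p.1 0 + 2 * max (p.1 1 + p.2 1 - p.1 0) 0
  else if i = n then p.1 (n-1) - p.1 n
  else if i = n - 1 then
    p.1 (n-2) - p.1 (n-1) + max (2 * p.1 n - p.1 (n-1) - p.2 (n-1)) 0
  else p.1 (i-1) - p.1 i + max (p.1 (i+1) + p.2 (i+1) - p.1 i - p.2 i) 0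

/-- Target `ε`-functions, with `l(b) = Σ_{i=1}^n (b_i + b̄_i)`. -/
def epsB (n i : ℕ) (q : Pt) : ℤ :=
  if i = 0 then -(∑ j ∈ Finset.Icc 1 n, (q.1 j + q.2 j)) + 2 * max (q.1 1 - q.2 1) 0
  else if i = n then q.2 n
  else q.2 i + max (q.1 (i+1) - q.2 (i+1)) 0

/-- The barred coordinates of a source point, extended by `x̄_n = x_n`. -/
def bar (n : ℕ) (p : Pt) (j : ℕ) : ℤ := if j = n then p.1 n else p.2 j

theorem μ_fst {n : ℕ} (hn : 2 ≤ n) {p : Pt} (hp : p ∈ S n) {j : ℕ} (h1 : 1 ≤ j) (h2 : j ≤ n) :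
    (μ n p).1 j = bar n p j - bar n p (j - 1) := by
  have h0 := hp.2 0 (Or.inl rfl)
  rcases eq_or_ne j 1 with rfl | hj
  · simp [μ, bar, h0, show 1 ≠ n by omega, show 0 ≠ n by omega]
  · rcases eq_or_ne j n with rfl | hjn
    · simp [μ, bar, hj, show ¬ j ≤ j - 1 by omega, show j - 1 ≠ j by omega]
    · simp [μ, bar, hj, hjn, show 2 ≤ j by omega, show j ≤ n - 1 by omega,
        show j - 1 ≠ n by omega]

theorem μ_snd {n : ℕ} (p : Pt) {j : ℕ} (h1 : 1 ≤ j) (h2 : j ≤ n) :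
    (μ n p).2 j = p.1 (j - 1) - p.1 j := by
  simp [μ, h1, h2]

theorem μ_mem {n : ℕ} (hn : 2 ≤ n) (p : Pt) : μ n p ∈ B n := by
  intro j hj
  constructor <;> simp only [μ] <;> split_ifs <;> omega

theorem sum_Icc_sub (f : ℕ → ℤ) (m : ℕ) :
    ∑ j ∈ Finset.Icc 1 m, (f j - f (j - 1)) = f m - f 0 := by
  induction m with
  | zero => simp
  | succ k ih => rw [Finset.sum_Icc_succ_top (by omega), ih]; simp

theorem sum_μ {n : ℕ} (hn : 2 ≤ n) {p : Pt} (hp : p ∈ S n) :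
    ∑ j ∈ Finset.Icc 1 n, ((μ n p).1 j + (μ n p).2 j) = p.1 0 := by
  have h : ∀ j ∈ Finset.Icc 1 n, (μ n p).1 j + (μ n p).2 j =
      (bar n p j - p.1 j) - (bar n p (j - 1) - p.1 (j - 1)) := by
    intro j hj
    rw [Finset.mem_Icc] at hj
    rw [μ_fst hn hp hj.1 hj.2, μ_snd p hj.1 hj.2]
    ring
  rw [Finset.sum_congr rfl h, sum_Icc_sub (fun j => bar n p j - p.1 j)]
  have h0 := hp.2 0 (Or.inl rfl)
  simp [bar, h0, show 0 ≠ n by omega]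

theorem bar_eq_sum {n : ℕ} (hn : 2 ≤ n) {p : Pt} (hp : p ∈ S n) {j : ℕ} (hj : j ≤ n) :
    bar n p j = ∑ k ∈ Finset.Icc 1 j, (μ n p).1 k := by
  have h : ∀ k ∈ Finset.Icc 1 j, (μ n p).1 k = bar n p k - bar n p (k - 1) := by
    intro k hk
    rw [Finset.mem_Icc] at hk
    exact μ_fst hn hp hk.1 (hk.2.trans hj)
  rw [Finset.sum_congr rfl h, sum_Icc_sub (bar n p)]
  have h0 := hp.2 0 (Or.inl rfl)
  simp [bar, h0, show 0 ≠ n by omega]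

theorem fst_eq_sub_sum {n : ℕ} (p : Pt) {j : ℕ} (hj : j ≤ n) :
    p.1 j = p.1 0 - ∑ k ∈ Finset.Icc 1 j, (μ n p).2 k := by
  have h : ∀ k ∈ Finset.Icc 1 j, (μ n p).2 k = -(p.1 k - p.1 (k - 1)) := by
    intro k hk
    rw [Finset.mem_Icc] at hk
    rw [μ_snd p hk.1 (hk.2.trans hj)]
    ring
  rw [Finset.sum_congr rfl h, Finset.sum_neg_distrib, sum_Icc_sub p.1]
  ring

theorem μ_injOn {n : ℕ} (hn : 2 ≤ n) : Set.InjOn (μ n) (S n) := by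
  intro p hp p' hp' h
  have h0 : p.1 0 = p'.1 0 := by rw [← sum_μ hn hp, ← sum_μ hn hp', h]
  ext j
  · by_cases hj : j ≤ n
    · rw [fst_eq_sub_sum p hj, fst_eq_sub_sum p' hj, h, h0]
    · rw [hp.1 j (by omega), hp'.1 j (by omega)]
  · by_cases hj : j < n
    · have hb : bar n p j = bar n p' j := by
        rw [bar_eq_sum hn hp hj.le, bar_eq_sum hn hp' hj.le, h]
      simpa [bar, hj.ne] using hb
    · rw [hp.2 j (by omega), hp'.2 j (by omega)]

/-- The inverse of `μ n`. -/
def ν (n : ℕ) (q : Pt) : Pt :=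
  (fun j => if j ≤ n then
      ∑ k ∈ Finset.Icc 1 n, (q.1 k + q.2 k) - ∑ k ∈ Finset.Icc 1 j, q.2 k else 0,
   fun j => if j < n then ∑ k ∈ Finset.Icc 1 j, q.1 k else 0)

theorem ν_mem {n : ℕ} (q : Pt) : ν n q ∈ S n := by
  constructor
  · intro j hj
    simp [ν, show ¬ j ≤ n by omega]
  · rintro j (rfl | hj)
    · simp [ν]
    · simp [ν, show ¬ j < n by omega]

theorem bar_ν {n : ℕ} (q : Pt) {j : ℕ} (hj : j ≤ n) :
    bar n (ν n q) j = ∑ k ∈ Finset.Icc 1 j, q.1 k := by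
  rcases eq_or_ne j n with rfl | h
  · simp [bar, ν, Finset.sum_add_distrib]
  · simp [bar, ν, h, show j < n by omega]

theorem μ_ν {n : ℕ} (hn : 2 ≤ n) {q : Pt} (hq : q ∈ B n) : μ n (ν n q) = q := by
  have hs (f : ℕ → ℤ) (j : ℕ) (hj : 1 ≤ j) :
      ∑ k ∈ Finset.Icc 1 j, f k = ∑ k ∈ Finset.Icc 1 (j - 1), f k + f j := by
    obtain ⟨m, rfl⟩ := Nat.exists_eq_add_of_le' hj
    rw [Finset.sum_Icc_succ_top (by omega)]
    simp
  ext j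
  · by_cases hj : 1 ≤ j ∧ j ≤ n
    · rw [μ_fst hn (ν_mem q) hj.1 hj.2, bar_ν q hj.2, bar_ν q (by omega), hs _ j hj.1]
      ring
    · rw [(hq j (by omega)).1, (μ_mem hn _ j (by omega)).1]
  · by_cases hj : 1 ≤ j ∧ j ≤ n
    · rw [μ_snd _ hj.1 hj.2]
      simp only [ν, hj.2, show j - 1 ≤ n by omega, if_true]
      rw [hs q.2 j hj.1]
      ring
    · rw [(hq j (by omega)).2, (μ_mem hn _ j (by omega)).2]

theorem μ_bijOn {n : ℕ} (hn : 2 ≤ n) : Set.BijOn (μ n) (S n) (B n) :=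
  ⟨fun p _ => μ_mem hn p, μ_injOn hn, fun q hq => ⟨ν n q, ν_mem q, μ_ν hn hq⟩⟩

theorem wtB_μ {n : ℕ} (hn : 2 ≤ n) {p : Pt} (hp : p ∈ S n) {i : ℕ} (hi : i ≤ n) :
    wtB n i (μ n p) = wtS n i p := by
  have h0 := hp.2 0 (Or.inl rfl)
  rcases Nat.eq_zero_or_pos i with rfl | hi0
  · simp only [wtB, wtS, if_true]
    rw [μ_fst hn hp le_rfl (by omega), μ_snd p le_rfl (by omega)]
    simp only [bar, show 1 ≠ n by omega, show 1 - 1 ≠ n by omega, if_false]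
    simp [h0]
    ring
  rcases eq_or_ne i n with rfl | hin
  · simp only [wtB, wtS, hi0.ne', if_true, if_false]
    rw [μ_fst hn hp hi0 hi, μ_snd p hi0 hi]
    simp only [bar, show i - 1 ≠ i by omega, if_true, if_false]
    ring
  simp only [wtB, wtS, hi0.ne', hin, if_false]
  rw [μ_fst hn hp hi0 hi, μ_snd p hi0 hi, μ_fst hn hp (by omega) (by omega),
    μ_snd p (by omega) (by omega)]
  simp only [bar, hin, show i - 1 ≠ n by omega, add_tsub_cancel_right, if_false]
  rcases eq_or_ne (i + 1) n with rfl | hin'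
  · simp only [add_tsub_cancel_right, if_true, show i + 1 - 2 = i - 1 by omega]
    ring
  · simp only [hin', show i ≠ n - 1 by omega, if_false]
    split_ifs with hi1
    · subst hi1
      simp [h0]
      ring
    · ring

theorem epsB_μ {n : ℕ} (hn : 2 ≤ n) {p : Pt} (hp : p ∈ S n) {i : ℕ} (hi : i ≤ n) :
    epsB n i (μ n p) = epsS n i p := by
  have h0 := hp.2 0 (Or.inl rfl)
  rcases Nat.eq_zero_or_pos i with rfl | hi0
  · simp only [epsB, epsS, if_true]
    rw [sum_μ hn hp, μ_fst hn hp le_rfl (by omega), μ_snd p le_rfl (by omega)]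
    simp only [bar, show 1 ≠ n by omega, show 1 - 1 ≠ n by omega, if_false]
    simp only [tsub_self, h0]
    congr 3
    ring
  rcases eq_or_ne i n with rfl | hin
  · simp only [epsB, epsS, hi0.ne', if_true, if_false]
    exact μ_snd p hi0 hi
  simp only [epsB, epsS, hi0.ne', hin, if_false]
  rw [μ_snd p hi0 hi, μ_fst hn hp (by omega) (by omega), μ_snd p (by omega) (by omega)]
  simp only [bar, hin, add_tsub_cancel_right, if_false]
  rcases eq_or_ne (i + 1) n with rfl | hin'
  · simp only [add_tsub_cancel_right, if_true, show i + 1 - 2 = i - 1 by omega]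
    congr 2
    ring
  · simp only [hin', show i ≠ n - 1 by omega, if_false]
    congr 2
    ring

theorem μ_eS {n : ℕ} (hn : 2 ≤ n) {p : Pt} (hp : p ∈ S n) {i : ℕ} (hi : i ≤ n) :
    μ n (eS n i p) = eB n i (μ n p) := by
  rcases Nat.eq_zero_or_pos i with rfl | hi0
  · have hc : (μ n p).1 1 > (μ n p).2 1 ↔ ¬ p.1 0 ≥ p.1 1 + p.2 1 := by
      simp [μ, show 1 ≤ n by omega]; omega
    simp only [eB, eS, if_true, hc]
    split_ifs <;> ext j <;> simp only [μ] <;> grind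
  rcases eq_or_ne i n with rfl | hin
  · simp only [eB, eS, hi0.ne', if_true, if_false]
    ext j <;> simp only [μ] <;> grind
  have hc : (μ n p).1 (i + 1) > (μ n p).2 (i + 1) ↔
      bar n p (i + 1) + p.1 (i + 1) > p.1 i + p.2 i := by
    rw [μ_fst hn hp (by omega) (by omega), μ_snd p (by omega) (by omega)]
    simp only [bar, add_tsub_cancel_right, hin, if_false]
    constructor <;> intro h <;> linarith
  simp only [eB, eS, hi0.ne', hin, if_false, hc]
  rcases eq_or_ne (i + 1) n with rfl | hin'
  · simp only [bar, add_tsub_cancel_right, if_true]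
    split_ifs <;> first | omega | (ext j <;> simp only [μ] <;> grind)
  · simp only [bar, hin', show i ≠ n - 1 by omega, if_false]
    split_ifs <;> first | omega | (ext j <;> simp only [μ] <;> grind)

/-- `μ` is a bijection of `ℤ^{2n}` onto `B_∞(A_{2n}^{(2)})` commuting with the
crystal operators and preserving `wt_i` and `ε_i`; hence
`UD(V(A_{2n}^{(2)†})) ≅ B_∞(A_{2n}^{(2)})`. -/
theorem stmt18 (n : ℕ) (hn : 2 ≤ n) :
    Set.BijOn (μ n) (S n) (B n) ∧
    ∀ p ∈ S n, ∀ i ≤ n,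
      μ n (eS n i p) = eB n i (μ n p) ∧
      wtB n i (μ n p) = wtS n i p ∧
      epsB n i (μ n p) = epsS n i p := by
  exact ⟨μ_bijOn hn, fun p hp i hi => ⟨μ_eS hn hp hi, wtB_μ hn hp hi, epsB_μ hn hp hi⟩⟩

end Stmt18
end
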